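/- arXiv:1607.07600 — 3 statements merged into one kernel-verified Lean document; each statement's English description precedes it below -/
import Mathlib

section
/- Fix I, J ≥ 2 and θ ∈ Δ_{IJ−1} satisfying the independence model, i.e., θ_{ij} = a_i b_j for all i,j where a_i > 0, b_j > 0, Σ_i a_i = Σ_j b_j = 1. For each n, let X^{(n)} = (X^{(n)}_{ij}) have the multinomial distribution with parameters (n, θ), and on the event that all row sums X^{(n)}_{i+} and column sums X^{(n)}_{+j} are positive define the Pearson statistic χ²_n = Σ_{i,j} (X^{(n)}_{ij} − X^{(n)}_{i+}X^{(n)}_{+j}/n)² / (X^{(n)}_{i+}X^{(n)}_{+j}/n) (defined arbitrarily, say 0, otherwise). Then χ²_n converges in distribution, as n → ∞, to the chi-square distribution with (I−1)(J−1) degrees of freedom; i.e., for every u > 0, lim_{n→∞} P(χ²_n ≥ u) = P(V ≥ u) where V ∼ χ²_{(I−1)(J−1)}. -/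
open Finset Filter ProbabilityTheory

/-- The multinomial probability mass function with parameters `(n, θ)` on `I × J` tables:
`P(X = x) = n!/(∏ x_{ij}!) ∏ θ_{ij}^{x_{ij}}` if `∑ x_{ij} = n`, and `0` otherwise. -/
noncomputable def multinomialPMF {I J : ℕ} (n : ℕ) (θ : Fin I → Fin J → ℝ)
    (x : Fin I → Fin J → ℕ) : ℝ :=
  if ∑ i, ∑ j, x i j = n then
    (n.factorial : ℝ) / (∏ i, ∏ j, ((x i j).factorial : ℝ)) * ∏ i, ∏ j, θ i j ^ x i j
  else 0

/-- The Pearson goodness-of-fit chi-square statistic of a table `x` with sample size `n`: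
`∑_{ij} (x_{ij} - x_{i+} x_{+j}/n)² / (x_{i+} x_{+j}/n)` when all row sums and column sums
are positive, and (arbitrarily) `0` otherwise. -/
noncomputable def pearsonChiSq {I J : ℕ} (n : ℕ) (x : Fin I → Fin J → ℕ) : ℝ :=
  if (∀ i, 0 < ∑ j, x i j) ∧ (∀ j, 0 < ∑ i, x i j) then
    ∑ i, ∑ j,
      ((x i j : ℝ) - (∑ j', x i j' : ℕ) * (∑ i', x i' j : ℕ) / n) ^ 2 /
        ((∑ j', x i j' : ℕ) * (∑ i', x i' j : ℕ) / n)
  else 0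

open MeasureTheory

lemma PA_mgf_gamma {a t : ℝ} (ha : 0 < a) (ht : t < 1/2) :
    mgf id (gammaMeasure a (1/2)) t = ((1/2) / (1/2 - t)) ^ a := by
  have ht' : 0 < 1/2 - t := by linarith
  have hpdf : Measurable (gammaPDF a (1/2)) := by
    unfold gammaPDF
    exact (measurable_gammaPDFReal a (1/2)).ennreal_ofReal
  rw [mgf, gammaMeasure, integral_withDensity_eq_integral_toReal_smul hpdf
    (by simp [gammaPDF])]
  have h1 : ∀ x, ((gammaPDF a (1/2) x).toReal • Real.exp (t * id x)) =
      Set.indicator (Set.Ici 0) (fun x => ((1/2)^a / Real.Gamma a) *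
        (x ^ (a - 1) * Real.exp (-((1/2 - t) * x)))) x := by
    intro x
    rw [gammaPDF, ENNReal.toReal_ofReal (gammaPDFReal_nonneg ha (by norm_num) x), gammaPDFReal]
    by_cases hx : 0 ≤ x
    · rw [Set.indicator_of_mem (by simpa using hx), if_pos hx]
      simp only [id, smul_eq_mul]
      rw [mul_assoc, ← Real.exp_add, mul_assoc]
      congr 3
      ring
    · rw [Set.indicator_of_notMem (by simpa using hx), if_neg hx]
      simp
  simp_rw [h1]
  rw [integral_indicator measurableSet_Ici, integral_Ici_eq_integral_Ioi, integral_const_mul,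
    Real.integral_rpow_mul_exp_neg_mul_Ioi ha ht', Real.div_rpow (by norm_num) ht'.le,
    Real.div_rpow (by norm_num) ht'.le]
  have := (Real.Gamma_pos_of_pos ha).ne'
  field_simp
  simp

lemma PA_mgf_sq {t : ℝ} (ht : t < 1/2) :
    ∫ x, Real.exp (t * x ^ 2) ∂(gaussianReal 0 1) = ((1/2) / (1/2 - t)) ^ (1/2 : ℝ) := by
  have ht' : 0 < 1/2 - t := by linarith
  rw [integral_gaussianReal_eq_integral_smul (by simp)]
  have h1 : ∀ x : ℝ, gaussianPDFReal 0 1 x • Real.exp (t * x ^ 2) =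
      (Real.sqrt (2 * Real.pi))⁻¹ * Real.exp (-(1/2 - t) * x ^ 2) := by
    intro x
    simp only [gaussianPDFReal, smul_eq_mul, NNReal.coe_one, mul_one, sub_zero]
    rw [mul_assoc, ← Real.exp_add]
    congr 2
    ring
  simp_rw [h1]
  rw [integral_const_mul, integral_gaussian, ← Real.sqrt_eq_rpow, ← Real.sqrt_inv,
    ← Real.sqrt_mul (by positivity)]
  congr 1
  have := Real.pi_pos.ne'
  field_simp

lemma PA_ext_mgf {μ ν : Measure ℝ} [IsProbabilityMeasure μ] [IsProbabilityMeasure ν]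
    (h : ∀ t < (1/2 : ℝ), mgf id μ t = mgf id ν t) (hpos : ∀ t < (1/2:ℝ), 0 < mgf id μ t) :
    μ = ν := by
  have h1 : Set.Iio (1/2 : ℝ) ⊆ interior (integrableExpSet id μ) := by
    rw [isOpen_Iio.subset_interior_iff]
    intro t ht
    exact mgf_pos_iff.1 (hpos t ht)
  have h2 : Set.Iio (1/2 : ℝ) ⊆ interior (integrableExpSet id ν) := by
    rw [isOpen_Iio.subset_interior_iff]
    intro t ht
    exact mgf_pos_iff.1 (h t ht ▸ hpos t ht)
  have hX : AnalyticOnNhd ℂ (complexMGF id μ) {z | z.re ∈ Set.Iio (1/2 : ℝ)} :=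
    analyticOnNhd_complexMGF.mono (fun z hz => h1 hz)
  have hY : AnalyticOnNhd ℂ (complexMGF id ν) {z | z.re ∈ Set.Iio (1/2 : ℝ)} :=
    analyticOnNhd_complexMGF.mono (fun z hz => h2 hz)
  have key := AnalyticOnNhd.eqOn_of_preconnected_of_frequently_eq hX hY
    ((convex_Iio (1/2:ℝ)).linear_preimage Complex.reLm).isPreconnected
    (z₀ := ((0 : ℝ) : ℂ)) (by simp) ?_
  · refine Measure.ext_of_charFun ?_
    ext t
    rw [← complexMGF_id_mul_I, ← complexMGF_id_mul_I]
    exact key (by simp)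
  · have h_real : ∃ᶠ (x : ℝ) in nhdsWithin 0 {0}ᶜ, complexMGF id μ x = complexMGF id ν x := by
      refine Eventually.frequently ?_
      filter_upwards [mem_nhdsWithin_of_mem_nhds (Iio_mem_nhds (by norm_num : (0:ℝ) < 1/2))]
        with y hy
      rw [complexMGF_ofReal, complexMGF_ofReal, h y hy]
    rw [frequently_iff_seq_forall] at h_real ⊢
    obtain ⟨xs, hx_tendsto, hx_eq⟩ := h_real
    refine ⟨fun n ↦ xs n, ?_, fun n ↦ ?_⟩
    · rw [tendsto_nhdsWithin_iff] at hx_tendsto ⊢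
      constructor
      · rw [tendsto_ofReal_iff]
        exact hx_tendsto.1
      · simpa using hx_tendsto.2
    · simp [hx_eq]

lemma PA_chiSq {ι : Type*} [Fintype ι] [DecidableEq ι] (T : Finset ι) (hT : 0 < T.card) :
    (Measure.pi (fun _ : ι => gaussianReal 0 1)).map (fun w => ∑ p ∈ T, w p ^ 2) =
      gammaMeasure ((T.card : ℝ) / 2) (1/2) := by
  have hm : Measurable (fun w : ι → ℝ => ∑ p ∈ T, w p ^ 2) := by fun_prop
  have hc : 0 < (T.card : ℝ) / 2 := by positivity
  have := isProbabilityMeasure_gammaMeasure hc (by norm_num : (0:ℝ) < 1/2)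
  have : IsProbabilityMeasure ((Measure.pi (fun _ : ι => gaussianReal 0 1)).map
      (fun w => ∑ p ∈ T, w p ^ 2)) := Measure.isProbabilityMeasure_map hm.aemeasurable
  symm
  refine PA_ext_mgf (fun t ht => ?_) (fun t ht => ?_)
  · have ht' : 0 < 1/2 - t := by linarith
    rw [PA_mgf_gamma hc ht, mgf_id_map hm.aemeasurable, mgf]
    have h1 : ∀ w : ι → ℝ, Real.exp (t * ∑ p ∈ T, w p ^ 2) =
        ∏ p, (fun (p : ι) (x : ℝ) => if p ∈ T then Real.exp (t * x ^ 2) else 1) p (w p) := by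
      intro w
      rw [Finset.mul_sum, Real.exp_sum, Finset.prod_ite_mem, Finset.univ_inter]
    simp_rw [h1]
    rw [integral_fintype_prod_eq_prod (f := fun (p : ι) (x : ℝ) => if p ∈ T then Real.exp (t * x ^ 2) else 1)]
    have h2 : ∀ p : ι, ∫ x, (if p ∈ T then Real.exp (t * x ^ 2) else 1) ∂(gaussianReal 0 1) =
      if p ∈ T then ((1/2) / (1/2 - t)) ^ (1/2 : ℝ) else 1 := by
      intro p
      split_ifs
      · exact PA_mgf_sq ht
      · simp
    simp_rw [h2]
    rw [Finset.prod_ite_mem, Finset.univ_inter, Finset.prod_const, ← Real.rpow_natCast,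
      ← Real.rpow_mul (by positivity)]
    congr 1
    ring
  · have ht' : 0 < 1/2 - t := by linarith
    rw [PA_mgf_gamma hc ht]
    positivity

section PB
set_option linter.unusedSectionVars false
variable {K : Type*} [Fintype K] [DecidableEq K]

/-- multinomial weight -/
noncomputable def PB_p (θ : K → ℝ) (x : K → ℕ) : ℝ :=
  (Nat.multinomial univ x : ℝ) * ∏ k, θ k ^ x k

/-- standardized count vector -/
noncomputable def PB_Z (θ : K → ℝ) (n : ℕ) (x : K → ℕ) : EuclideanSpace ℝ K :=
  WithLp.toLp 2 (fun k => ((x k : ℝ) - n * θ k) / (Real.sqrt n * Real.sqrt (θ k)))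

/-- law of the standardized count vector -/
noncomputable def PB_law (θ : K → ℝ) (n : ℕ) : Measure (EuclideanSpace ℝ K) :=
  ∑ x ∈ piAntidiag univ n, ENNReal.ofReal (PB_p θ x) • Measure.dirac (PB_Z θ n x)

lemma PB_p_nonneg {θ : K → ℝ} (hθ : ∀ k, 0 < θ k) (x : K → ℕ) : 0 ≤ PB_p θ x :=
  mul_nonneg (Nat.cast_nonneg _) (prod_nonneg fun k _ => pow_nonneg (hθ k).le _)

lemma PB_sum_p {θ : K → ℝ} (hsum : ∑ k, θ k = 1) (n : ℕ) :
    ∑ x ∈ piAntidiag univ n, PB_p θ x = 1 := by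
  unfold PB_p
  rw [← sum_pow_eq_sum_piAntidiag, hsum, one_pow]

lemma PB_apply (θ : K → ℝ) (n : ℕ) {s : Set (EuclideanSpace ℝ K)} (hs : MeasurableSet s) :
    PB_law θ n s = ∑ x ∈ piAntidiag univ n,
      ENNReal.ofReal (PB_p θ x) * s.indicator 1 (PB_Z θ n x) := by
  simp [PB_law, Measure.dirac_apply' _ hs]

lemma PB_prob {θ : K → ℝ} (hθ : ∀ k, 0 < θ k) (hsum : ∑ k, θ k = 1) (n : ℕ) :
    IsProbabilityMeasure (PB_law θ n) := by
  constructor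
  rw [PB_apply _ _ MeasurableSet.univ]
  simp only [Set.indicator_univ, Pi.one_apply, mul_one]
  rw [← ENNReal.ofReal_sum_of_nonneg (fun x _ => PB_p_nonneg hθ x), PB_sum_p hsum]
  simp

/-- finite measure on the line -/
noncomputable def PB_fin (θ X : K → ℝ) : Measure ℝ :=
  ∑ k, ENNReal.ofReal (θ k) • Measure.dirac (X k)

lemma PB_fin_prob {θ : K → ℝ} (hθ : ∀ k, 0 < θ k) (hsum : ∑ k, θ k = 1) (X : K → ℝ) :
    IsProbabilityMeasure (PB_fin θ X) := by
  constructor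
  simp only [PB_fin, Measure.coe_finsetSum, Measure.coe_smul, Finset.sum_apply, Pi.smul_apply,
    measure_univ, smul_eq_mul, mul_one]
  rw [← ENNReal.ofReal_sum_of_nonneg (fun x _ => (hθ x).le), hsum]
  simp

lemma PB_fin_integral {F : Type*} [NormedAddCommGroup F] [NormedSpace ℝ F] [CompleteSpace F]
    {θ : K → ℝ} (hθ : ∀ k, 0 < θ k) (X : K → ℝ) (f : ℝ → F) :
    ∫ y, f y ∂(PB_fin θ X) = ∑ k, θ k • f (X k) := by
  rw [PB_fin, integral_finsetSum_measure]
  · refine sum_congr rfl fun k _ => ?_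
    rw [integral_smul_measure, integral_dirac, ENNReal.toReal_ofReal (hθ k).le]
  · intro k _
    exact (integrable_dirac (by simp)).smul_measure (by simp)

lemma PB_law_integral {F : Type*} [NormedAddCommGroup F] [NormedSpace ℝ F] [CompleteSpace F]
    {θ : K → ℝ} (hθ : ∀ k, 0 < θ k) (n : ℕ) (f : EuclideanSpace ℝ K → F) :
    ∫ y, f y ∂(PB_law θ n) = ∑ x ∈ piAntidiag univ n, PB_p θ x • f (PB_Z θ n x) := by
  rw [PB_law, integral_finsetSum_measure]
  · refine sum_congr rfl fun k _ => ?_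
    rw [integral_smul_measure, integral_dirac, ENNReal.toReal_ofReal (PB_p_nonneg hθ k)]
  · intro k _
    exact (integrable_dirac (by simp)).smul_measure (by simp)

/-- centered score -/
noncomputable def PB_X (θ : K → ℝ) (t : EuclideanSpace ℝ K) (k : K) : ℝ :=
  t k / Real.sqrt (θ k) - ∑ l, Real.sqrt (θ l) * t l

lemma PB_inner {θ : K → ℝ} (hθ : ∀ k, 0 < θ k) {n : ℕ} (hn : 0 < n)
    (t : EuclideanSpace ℝ K) {x : K → ℕ} (hx : ∑ k, x k = n) :
    inner ℝ (PB_Z θ n x) t = ∑ k, (x k : ℝ) * ((Real.sqrt n)⁻¹ * PB_X θ t k) := by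
  have hs : 0 < Real.sqrt n := Real.sqrt_pos.2 (by exact_mod_cast hn)
  have hss : Real.sqrt n * Real.sqrt n = n := Real.mul_self_sqrt (by positivity)
  have hx' : ∑ k, (x k : ℝ) = n := by exact_mod_cast hx
  have h1 : ∀ k, (x k : ℝ) * ((Real.sqrt n)⁻¹ * PB_X θ t k) =
      (x k : ℝ) * (t k / (Real.sqrt n * Real.sqrt (θ k)))
        - (x k : ℝ) * ((Real.sqrt n)⁻¹ * ∑ l, Real.sqrt (θ l) * t l) := by
    intro k
    have := Real.sqrt_pos.2 (hθ k)
    rw [PB_X]; field_simp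
  simp_rw [h1]
  rw [sum_sub_distrib, ← sum_mul, hx', PiLp.inner_apply, mul_sum, mul_sum, ← sum_sub_distrib]
  refine sum_congr rfl fun k _ => ?_
  have h2 := Real.sqrt_pos.2 (hθ k)
  have h3 : Real.sqrt (θ k) * Real.sqrt (θ k) = θ k := Real.mul_self_sqrt (hθ k).le
  simp only [PB_Z, RCLike.inner_apply, conj_trivial]
  rw [← hss]
  field_simp
  rw [sq (Real.sqrt (θ k)), h3]

lemma PB_charFun {θ : K → ℝ} (hθ : ∀ k, 0 < θ k) {n : ℕ} (hn : 0 < n)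
    (t : EuclideanSpace ℝ K) :
    charFun (PB_law θ n) t = (charFun (PB_fin θ (PB_X θ t)) ((Real.sqrt n)⁻¹)) ^ n := by
  rw [charFun_apply, PB_law_integral hθ, charFun_apply_real, PB_fin_integral hθ,
    sum_pow_eq_sum_piAntidiag]
  refine sum_congr rfl fun x hx => ?_
  have hx' : ∑ k, x k = n := (mem_piAntidiag.1 hx).1
  rw [PB_inner hθ hn t hx', PB_p]
  simp only [Complex.real_smul, mul_pow, prod_mul_distrib]
  push_cast
  rw [mul_assoc]
  congr 2
  rw [sum_mul, Complex.exp_sum]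
  refine prod_congr rfl fun k _ => ?_
  rw [← Complex.exp_nat_mul]
  congr 1
  ring

lemma PB_mean {θ : K → ℝ} (hθ : ∀ k, 0 < θ k) (hsum : ∑ k, θ k = 1)
    (t : EuclideanSpace ℝ K) : ∑ k, θ k * PB_X θ t k = 0 := by
  have h1 : ∀ k, θ k * PB_X θ t k =
      Real.sqrt (θ k) * t k - θ k * ∑ l, Real.sqrt (θ l) * t l := by
    intro k
    have h2 := Real.sqrt_pos.2 (hθ k)
    have h3 : Real.sqrt (θ k) * Real.sqrt (θ k) = θ k := Real.mul_self_sqrt (hθ k).le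
    rw [PB_X, mul_sub]
    congr 1
    nth_rw 1 [← h3]
    field_simp
  simp_rw [h1]
  rw [sum_sub_distrib, ← sum_mul, hsum]
  ring

lemma PB_var {θ : K → ℝ} (hθ : ∀ k, 0 < θ k) (hsum : ∑ k, θ k = 1)
    (t : EuclideanSpace ℝ K) : ∑ k, θ k * PB_X θ t k ^ 2 =
      ‖t‖ ^ 2 - (∑ l, Real.sqrt (θ l) * t l) ^ 2 := by
  have h1 : ∀ k, θ k * PB_X θ t k ^ 2 =
      t k ^ 2 - 2 * (Real.sqrt (θ k) * t k) * (∑ l, Real.sqrt (θ l) * t l)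
        + θ k * (∑ l, Real.sqrt (θ l) * t l) ^ 2 := by
    intro k
    have h2 := Real.sqrt_pos.2 (hθ k)
    have h3 : Real.sqrt (θ k) ^ 2 = θ k := Real.sq_sqrt (hθ k).le
    rw [PB_X]
    nth_rw 1 [← h3]
    nth_rw 4 [← h3]
    field_simp
    ring
  simp_rw [h1]
  rw [sum_add_distrib, sum_sub_distrib, ← sum_mul, ← sum_mul, hsum, ← mul_sum,
    EuclideanSpace.real_norm_sq_eq]
  ring

lemma PB_clt {θ : K → ℝ} (hθ : ∀ k, 0 < θ k) (hsum : ∑ k, θ k = 1)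
    (t : EuclideanSpace ℝ K) :
    Tendsto (fun n : ℕ => charFun (PB_law θ n) t) atTop
      (nhds (Complex.exp (-((‖t‖ ^ 2 - (∑ l, Real.sqrt (θ l) * t l) ^ 2 : ℝ) : ℂ) / 2))) := by
  rw [← PB_var hθ hsum]
  set v : ℝ := ∑ k, θ k * PB_X θ t k ^ 2 with hv
  have hv0 : 0 ≤ v := sum_nonneg fun k _ => mul_nonneg (hθ k).le (sq_nonneg _)
  have key : Tendsto (fun n : ℕ =>
      (charFun (PB_fin θ (PB_X θ t)) ((Real.sqrt n)⁻¹)) ^ n) atTop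
      (nhds (Complex.exp (-(v : ℂ) / 2))) := by
    have hcf : ∀ (X : K → ℝ) (s : ℝ), charFun (PB_fin θ X) s =
        ∑ k, θ k • Complex.exp (s * X k * Complex.I) := by
      intro X s
      rw [charFun_apply_real, PB_fin_integral hθ]
    rcases hv0.eq_or_lt with h0 | hpos
    · have hX : ∀ k, PB_X θ t k = 0 := by
        intro k
        have := (sum_eq_zero_iff_of_nonneg
          (fun k _ => mul_nonneg (hθ k).le (sq_nonneg (PB_X θ t k)))).1 h0.symm k (mem_univ k)
        simpa [(hθ k).ne'] using this
      rw [← h0]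
      have : ∑ k, (θ k : ℂ) = 1 := by exact_mod_cast hsum
      simp [hcf, hX, this]
    · set σ := Real.sqrt v with hσ
      have hσ0 : 0 < σ := Real.sqrt_pos.2 hpos
      have hσ2 : σ ^ 2 = v := Real.sq_sqrt hv0
      have := PB_fin_prob hθ hsum (fun k => PB_X θ t k / σ)
      have h := tendsto_charFun_inv_sqrt_mul_pow (P := PB_fin θ (fun k => PB_X θ t k / σ))
        (X := id) aemeasurable_id ?_ ?_ σ
      · rw [Measure.map_id] at h
        have e1 : (-(σ:ℂ) ^ 2 / 2) = -(v : ℂ) / 2 := by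
          rw [← hσ2]; push_cast; ring
        rw [e1] at h
        refine h.congr fun n => ?_
        congr 1
        rw [hcf, hcf]
        refine sum_congr rfl fun k _ => ?_
        congr 2
        have : (σ : ℂ) ≠ 0 := by exact_mod_cast hσ0.ne'
        push_cast
        field_simp
      · rw [PB_fin_integral hθ]
        simp only [id, smul_eq_mul]
        simp_rw [← mul_div_assoc]
        rw [← sum_div, PB_mean hθ hsum, zero_div]
      · rw [PB_fin_integral hθ]
        simp only [Pi.pow_apply, id, smul_eq_mul, div_pow]
        simp_rw [← mul_div_assoc]
        rw [← sum_div, ← hv, hσ2, div_self hpos.ne']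
  refine key.congr' ?_
  filter_upwards [eventually_gt_atTop 0] with n hn
  rw [PB_charFun hθ hn]

/-- limit law -/
noncomputable def PB_lim (s : EuclideanSpace ℝ K) : Measure (EuclideanSpace ℝ K) :=
  (stdGaussian (EuclideanSpace ℝ K)).map (fun z => z - inner ℝ s z • s)

instance (s : EuclideanSpace ℝ K) : IsProbabilityMeasure (PB_lim s) :=
  Measure.isProbabilityMeasure_map (by fun_prop)

lemma PB_lim_charFun {s : EuclideanSpace ℝ K} (hs : ‖s‖ = 1) (t : EuclideanSpace ℝ K) :
    charFun (PB_lim s) t = Complex.exp (-((‖t‖ ^ 2 - (inner ℝ s t) ^ 2 : ℝ) : ℂ) / 2) := by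
  rw [charFun_apply, PB_lim, integral_map (by fun_prop) (by fun_prop)]
  have h1 : ∀ z : EuclideanSpace ℝ K, inner ℝ (z - inner ℝ s z • s) t =
      inner ℝ z (t - inner ℝ s t • s) := by
    intro z
    rw [inner_sub_left, inner_sub_right, inner_smul_left, inner_smul_right, real_inner_comm s z]
    simp
    ring
  simp_rw [h1]
  rw [← charFun_apply, charFun_stdGaussian]
  have h2 : ‖t - inner ℝ s t • s‖ ^ 2 = ‖t‖ ^ 2 - (inner ℝ s t) ^ 2 := by
    rw [norm_sub_sq_real, inner_smul_right, norm_smul, hs, real_inner_comm]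
    simp
    ring
  rw [← h2]
  push_cast
  rfl

/-- law of the standardized count vector, bundled -/
noncomputable def PB_lawP {θ : K → ℝ} (hθ : ∀ k, 0 < θ k) (hsum : ∑ k, θ k = 1) (n : ℕ) :
    ProbabilityMeasure (EuclideanSpace ℝ K) := ⟨PB_law θ n, PB_prob hθ hsum n⟩

/-- limit law, bundled -/
noncomputable def PB_limP (s : EuclideanSpace ℝ K) :
    ProbabilityMeasure (EuclideanSpace ℝ K) := ⟨PB_lim s, inferInstance⟩

/-- dirac, bundled -/
noncomputable def PB_diracP (c : ℝ) : ProbabilityMeasure ℝ := ⟨Measure.dirac c, inferInstance⟩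

lemma PB_tendsto {θ : K → ℝ} (hθ : ∀ k, 0 < θ k) (hsum : ∑ k, θ k = 1) :
    Tendsto (fun n : ℕ => PB_lawP hθ hsum n) atTop
      (nhds (PB_limP (WithLp.toLp 2 fun k => Real.sqrt (θ k)))) := by
  refine ProbabilityMeasure.tendsto_of_tendsto_charFun fun t => ?_
  have hs : ‖(WithLp.toLp 2 fun k => Real.sqrt (θ k) : EuclideanSpace ℝ K)‖ = 1 := by
    rw [← sq_eq_sq₀ (norm_nonneg _) (by norm_num), EuclideanSpace.real_norm_sq_eq]
    simp [Real.sq_sqrt (hθ _).le, hsum]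
  have h := PB_clt hθ hsum t
  simp only [PB_lawP, PB_limP, ProbabilityMeasure.coe_mk]
  rw [PB_lim_charFun hs]
  convert h using 6
  simp [PiLp.inner_apply, mul_comm]

lemma PB_dirac_tendsto {c : ℕ → ℝ} (hc : Tendsto c atTop (nhds 0)) :
    Tendsto (fun n => PB_diracP (c n)) atTop (nhds (PB_diracP 0)) := by
  refine ProbabilityMeasure.tendsto_of_tendsto_charFun fun t => ?_
  simp only [PB_diracP, ProbabilityMeasure.coe_mk, charFun_dirac]
  have : Continuous fun y : ℝ => Complex.exp ((inner ℝ y t : ℝ) * Complex.I) := by fun_prop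
  exact (this.tendsto 0).comp hc

/-- The mapping step: convergence of the probability of a superlevel set. -/
lemma PB_key {θ : K → ℝ} (hθ : ∀ k, 0 < θ k) (hsum : ∑ k, θ k = 1)
    {g : EuclideanSpace ℝ K × ℝ → ℝ} (hg : Measurable g)
    (hgc : ∀ z, ContinuousAt g (z, 0)) {ρ : Measure ℝ} {u : ℝ} (hu : ρ {u} = 0)
    (hρ : (PB_lim (WithLp.toLp 2 fun k => Real.sqrt (θ k))).map (fun z => g (z, 0)) = ρ) :
    Tendsto (fun n : ℕ => ∑ x ∈ piAntidiag univ n,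
      if u ≤ g (PB_Z θ n x, (Real.sqrt n)⁻¹) then PB_p θ x else 0) atTop
      (nhds (ρ {v | u ≤ v}).toReal) := by
  set S : Set (EuclideanSpace ℝ K × ℝ) := {p | u ≤ g p} with hS
  have hSm : MeasurableSet S := measurableSet_le measurable_const hg
  have hc : Tendsto (fun n : ℕ => (Real.sqrt n)⁻¹) atTop (nhds 0) :=
    tendsto_inv_atTop_zero.comp (Real.tendsto_sqrt_atTop.comp tendsto_natCast_atTop_atTop)
  have h1 := (ProbabilityMeasure.continuous_prod.tendsto
    (PB_limP (WithLp.toLp 2 fun k => Real.sqrt (θ k)), PB_diracP 0)).comp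
    ((PB_tendsto hθ hsum).prodMk_nhds (PB_dirac_tendsto hc))
  have hg0 : Measurable fun z : EuclideanSpace ℝ K => g (z, 0) := by fun_prop
  have hprod : ∀ (μ : Measure (EuclideanSpace ℝ K)) [SFinite μ] (c : ℝ)
      (A : Set (EuclideanSpace ℝ K × ℝ)), MeasurableSet A →
      (μ.prod (Measure.dirac c)) A = μ {z | (z, c) ∈ A} := by
    intro μ _ c A hA
    rw [Measure.prod_dirac, Measure.map_apply (by fun_prop) hA]
    rfl
  have hfr : ((PB_limP (WithLp.toLp 2 fun k => Real.sqrt (θ k))).prod (PB_diracP 0) :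
      Measure (EuclideanSpace ℝ K × ℝ)) (frontier S) = 0 := by
    rw [ProbabilityMeasure.toMeasure_prod]
    simp only [PB_limP, PB_diracP, ProbabilityMeasure.coe_mk]
    rw [hprod _ _ _ isClosed_frontier.measurableSet]
    refine measure_mono_null (t := (fun z => g (z, 0)) ⁻¹' {u}) ?_ ?_
    · intro z hz
      by_contra hne
      rcases lt_or_gt_of_ne hne with h | h
      · have : ∀ᶠ p in nhds (z, (0:ℝ)), g p < u := (hgc z).eventually_lt_const h
        have h3 : (z, (0:ℝ)) ∈ closure S := hz.1
        rw [mem_closure_iff_frequently] at h3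
        obtain ⟨p, hp1, hp2⟩ := (h3.and_eventually this).exists
        exact absurd hp2 (not_lt.2 hp1)
      · have : ∀ᶠ p in nhds (z, (0:ℝ)), u < g p := (hgc z).eventually_const_lt h
        exact hz.2 (mem_interior_iff_mem_nhds.2 (this.mono fun p hp => le_of_lt hp))
    · rw [← Measure.map_apply hg0 (measurableSet_singleton u), hρ, hu]
  have h2 := ProbabilityMeasure.tendsto_measure_of_null_frontier_of_tendsto' h1 hfr
  have h3 := (ENNReal.tendsto_toReal (measure_ne_top _ _)).comp h2
  have e1 : (((PB_limP (WithLp.toLp 2 fun k => Real.sqrt (θ k))).prod (PB_diracP 0) :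
      Measure (EuclideanSpace ℝ K × ℝ)) S) = ρ {v | u ≤ v} := by
    rw [ProbabilityMeasure.toMeasure_prod]
    simp only [PB_limP, PB_diracP, ProbabilityMeasure.coe_mk]
    rw [hprod _ _ _ hSm, ← hρ, Measure.map_apply hg0 (measurableSet_le measurable_const measurable_id :
      MeasurableSet {v : ℝ | u ≤ v})]
    rfl
  rw [e1] at h3
  refine h3.congr fun n => ?_
  simp only [Function.comp, ProbabilityMeasure.toMeasure_prod]
  simp only [PB_lawP, PB_diracP, ProbabilityMeasure.coe_mk]
  have := PB_prob hθ hsum n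
  have hSn : MeasurableSet {z : EuclideanSpace ℝ K | (z, (Real.sqrt n)⁻¹) ∈ S} :=
    hSm.preimage (f := fun z : EuclideanSpace ℝ K => (z, (Real.sqrt n)⁻¹)) (by fun_prop)
  rw [hprod _ _ _ hSm, PB_apply _ _ hSn,
    ENNReal.toReal_sum (fun x _ => by
      by_cases h : PB_Z θ n x ∈ {z | (z, (Real.sqrt n)⁻¹) ∈ S} <;> simp [h])]
  refine sum_congr rfl fun x _ => ?_
  by_cases h : u ≤ g (PB_Z θ n x, (Real.sqrt n)⁻¹)
  · have h' : PB_Z θ n x ∈ {z : EuclideanSpace ℝ K | (z, (Real.sqrt n)⁻¹) ∈ S} := h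
    rw [if_pos h, Set.indicator_of_mem h']
    simp [ENNReal.toReal_ofReal (PB_p_nonneg hθ x)]
  · have h' : PB_Z θ n x ∉ {z : EuclideanSpace ℝ K | (z, (Real.sqrt n)⁻¹) ∈ S} := h
    rw [if_neg h, Set.indicator_of_notMem h']
    simp

end PB

section PC
variable {I J : ℕ}

/-- row deviation -/
noncomputable def PC_r (a : Fin I → ℝ) (b : Fin J → ℝ) (z : EuclideanSpace ℝ (Fin I × Fin J))
    (i : Fin I) : ℝ := ∑ j, Real.sqrt (a i * b j) * z (i, j)

/-- column deviation -/
noncomputable def PC_s (a : Fin I → ℝ) (b : Fin J → ℝ) (z : EuclideanSpace ℝ (Fin I × Fin J))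
    (j : Fin J) : ℝ := ∑ i, Real.sqrt (a i * b j) * z (i, j)

/-- main rational expression -/
noncomputable def PC_f (a : Fin I → ℝ) (b : Fin J → ℝ)
    (p : EuclideanSpace ℝ (Fin I × Fin J) × ℝ) : ℝ :=
  ∑ i, ∑ j, (Real.sqrt (a i * b j) * p.1 (i, j) - a i * PC_s a b p.1 j - b j * PC_r a b p.1 i
      - p.2 * (PC_r a b p.1 i * PC_s a b p.1 j)) ^ 2 /
      ((a i + p.2 * PC_r a b p.1 i) * (b j + p.2 * PC_s a b p.1 j))

open Classical in
/-- the statistic as a function of the standardized counts -/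
noncomputable def PC_g (a : Fin I → ℝ) (b : Fin J → ℝ)
    (p : EuclideanSpace ℝ (Fin I × Fin J) × ℝ) : ℝ :=
  if (∀ i, 0 < a i + p.2 * PC_r a b p.1 i) ∧ (∀ j, 0 < b j + p.2 * PC_s a b p.1 j) then
    PC_f a b p else 0

lemma PC_r_cont (a : Fin I → ℝ) (b : Fin J → ℝ) (i : Fin I) :
    Continuous fun z => PC_r a b z i := by unfold PC_r; fun_prop

lemma PC_s_cont (a : Fin I → ℝ) (b : Fin J → ℝ) (j : Fin J) :
    Continuous fun z => PC_s a b z j := by unfold PC_s; fun_prop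

lemma PC_g_meas (a : Fin I → ℝ) (b : Fin J → ℝ) : Measurable (PC_g a b) := by
  have hr := fun i => (PC_r_cont a b i).measurable
  have hs := fun j => (PC_s_cont a b j).measurable
  unfold PC_g
  refine Measurable.ite ?_ ?_ measurable_const
  · refine MeasurableSet.inter ?_ ?_
    · show MeasurableSet {p : EuclideanSpace ℝ (Fin I × Fin J) × ℝ |
        ∀ i, 0 < a i + p.2 * PC_r a b p.1 i}
      rw [Set.ofPred_forall]
      exact MeasurableSet.iInter fun i => measurableSet_lt measurable_const
        (measurable_const.add (measurable_snd.mul ((hr i).comp measurable_fst)))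
    · show MeasurableSet {p : EuclideanSpace ℝ (Fin I × Fin J) × ℝ |
        ∀ j, 0 < b j + p.2 * PC_s a b p.1 j}
      rw [Set.ofPred_forall]
      exact MeasurableSet.iInter fun i => measurableSet_lt measurable_const
        (measurable_const.add (measurable_snd.mul ((hs i).comp measurable_fst)))
  · unfold PC_f
    have hr' := fun i => (hr i).comp
      (measurable_fst : Measurable (Prod.fst : EuclideanSpace ℝ (Fin I × Fin J) × ℝ → _))
    have hs' := fun j => (hs j).comp
      (measurable_fst : Measurable (Prod.fst : EuclideanSpace ℝ (Fin I × Fin J) × ℝ → _))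
    simp only [Function.comp_def] at hr' hs'
    fun_prop

lemma PC_g_contAt {a : Fin I → ℝ} {b : Fin J → ℝ} (ha : ∀ i, 0 < a i) (hb : ∀ j, 0 < b j)
    (z : EuclideanSpace ℝ (Fin I × Fin J)) : ContinuousAt (PC_g a b) (z, 0) := by
  have hr' : ∀ i, Continuous fun p : EuclideanSpace ℝ (Fin I × Fin J) × ℝ => PC_r a b p.1 i :=
    fun i => (PC_r_cont a b i).comp continuous_fst
  have hs' : ∀ j, Continuous fun p : EuclideanSpace ℝ (Fin I × Fin J) × ℝ => PC_s a b p.1 j :=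
    fun i => (PC_s_cont a b i).comp continuous_fst
  have h1 : ∀ᶠ p in nhds (z, (0:ℝ)), ∀ i, 0 < a i + p.2 * PC_r a b p.1 i := by
    refine eventually_all.2 fun i => ?_
    have hc : Continuous fun p : EuclideanSpace ℝ (Fin I × Fin J) × ℝ =>
      a i + p.2 * PC_r a b p.1 i := by fun_prop
    exact hc.continuousAt.eventually_const_lt (by simpa using ha i)
  have h2 : ∀ᶠ p in nhds (z, (0:ℝ)), ∀ j, 0 < b j + p.2 * PC_s a b p.1 j := by
    refine eventually_all.2 fun i => ?_
    have hc : Continuous fun p : EuclideanSpace ℝ (Fin I × Fin J) × ℝ =>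
      b i + p.2 * PC_s a b p.1 i := by fun_prop
    exact hc.continuousAt.eventually_const_lt (by simpa using hb i)
  have h3 : PC_f a b =ᶠ[nhds (z, (0:ℝ))] PC_g a b := by
    filter_upwards [h1, h2] with p hp1 hp2
    rw [PC_g, if_pos ⟨hp1, hp2⟩]
  refine ContinuousAt.congr ?_ h3
  unfold PC_f
  refine tendsto_finsetSum _ fun i _ => tendsto_finsetSum _ fun j _ => ?_
  refine ContinuousAt.div ?_ ?_ ?_
  · exact Continuous.continuousAt (by fun_prop)
  · exact Continuous.continuousAt (by fun_prop)
  · simpa using ⟨(ha i).ne', (hb j).ne'⟩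

lemma PC_g_zero {a : Fin I → ℝ} {b : Fin J → ℝ} (ha : ∀ i, 0 < a i) (hb : ∀ j, 0 < b j)
    (z : EuclideanSpace ℝ (Fin I × Fin J)) : PC_g a b (z, 0) =
      ∑ i, ∑ j, (z (i, j) - Real.sqrt (a i) * ∑ i', Real.sqrt (a i') * z (i', j)
        - Real.sqrt (b j) * ∑ j', Real.sqrt (b j') * z (i, j')) ^ 2 := by
  rw [PC_g, if_pos (by simpa using ⟨ha, hb⟩), PC_f]
  refine sum_congr rfl fun i _ => sum_congr rfl fun j _ => ?_
  have hA := Real.sqrt_pos.2 (ha i)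
  have hB := Real.sqrt_pos.2 (hb j)
  have hA2 := Real.sq_sqrt (ha i).le
  have hB2 := Real.sq_sqrt (hb j).le
  have e1 : PC_r a b z i = Real.sqrt (a i) * ∑ j', Real.sqrt (b j') * z (i, j') := by
    rw [PC_r, mul_sum]
    refine sum_congr rfl fun j' _ => ?_
    rw [Real.sqrt_mul (ha i).le]; ring
  have e2 : PC_s a b z j = Real.sqrt (b j) * ∑ i', Real.sqrt (a i') * z (i', j) := by
    rw [PC_s, mul_sum]
    refine sum_congr rfl fun i' _ => ?_
    rw [Real.sqrt_mul (ha i').le]; ring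
  simp only [zero_mul, add_zero, sub_zero]
  rw [e1, e2, Real.sqrt_mul (ha i).le]
  generalize (∑ j', Real.sqrt (b j') * z (i, j')) = R
  generalize (∑ i', Real.sqrt (a i') * z (i', j)) = S
  generalize z (i, j) = y
  rw [div_eq_iff (by have := ha i; have := hb j; positivity)]
  generalize hα : Real.sqrt (a i) = α at *
  generalize hβ : Real.sqrt (b j) = β at *
  rw [← hA2, ← hB2]
  ring

lemma PC_pearson {a : Fin I → ℝ} {b : Fin J → ℝ} (ha : ∀ i, 0 < a i) (hb : ∀ j, 0 < b j)
    (hasum : ∑ i, a i = 1) (hbsum : ∑ j, b j = 1) {n : ℕ} (hn : 0 < n)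
    (x : Fin I × Fin J → ℕ) :
    pearsonChiSq n (fun i j => x (i, j)) =
      PC_g a b (PB_Z (fun k => a k.1 * b k.2) n x, (Real.sqrt n)⁻¹) := by
  set c := Real.sqrt n with hc
  have hn' : (0:ℝ) < n := by exact_mod_cast hn
  have hc0 : 0 < c := Real.sqrt_pos.2 hn'
  have hcc : c ^ 2 = n := Real.sq_sqrt hn'.le
  set z := PB_Z (fun k : Fin I × Fin J => a k.1 * b k.2) n x with hz
  have hzz : ∀ i j, Real.sqrt (a i * b j) * z (i, j) = (x (i, j) - n * (a i * b j)) / c := by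
    intro i j
    have := Real.sqrt_pos.2 (mul_pos (ha i) (hb j))
    simp only [hz, PB_Z, ← hc]
    field_simp
  have hr : ∀ i, PC_r a b z i = ((∑ j, x (i, j) : ℕ) - n * a i) / c := by
    intro i
    rw [PC_r]
    simp_rw [hzz]
    rw [← sum_div, sum_sub_distrib, ← mul_sum, ← mul_sum, hbsum]
    push_cast
    ring
  have hs : ∀ j, PC_s a b z j = ((∑ i, x (i, j) : ℕ) - n * b j) / c := by
    intro j
    rw [PC_s]
    simp_rw [hzz]
    rw [← sum_div, sum_sub_distrib, ← mul_sum, ← sum_mul, hasum]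
    push_cast
    ring
  have hr2 : ∀ i, a i + c⁻¹ * PC_r a b z i = ((∑ j, x (i, j) : ℕ) : ℝ) / n := by
    intro i
    rw [hr, ← hcc]; field_simp; ring
  have hs2 : ∀ j, b j + c⁻¹ * PC_s a b z j = ((∑ i, x (i, j) : ℕ) : ℝ) / n := by
    intro i
    rw [hs, ← hcc]; field_simp; ring
  have hcond : ((∀ i, 0 < ∑ j, x (i, j)) ∧ (∀ j, 0 < ∑ i, x (i, j))) ↔
      ((∀ i, 0 < a i + c⁻¹ * PC_r a b z i) ∧ (∀ j, 0 < b j + c⁻¹ * PC_s a b z j)) := by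
    simp only [hr2, hs2, div_pos_iff_of_pos_right hn', Nat.cast_pos]
  rw [pearsonChiSq, PC_g]
  by_cases h : (∀ i, 0 < ∑ j, x (i, j)) ∧ (∀ j, 0 < ∑ i, x (i, j))
  · rw [if_pos h, if_pos (hcond.1 h), PC_f]
    refine sum_congr rfl fun i _ => sum_congr rfl fun j _ => ?_
    simp only
    rw [hr2, hs2, hzz, hr, hs]
    have h1 : (0:ℝ) < (∑ j, x (i, j) : ℕ) := by exact_mod_cast h.1 i
    have h2 : (0:ℝ) < (∑ i, x (i, j) : ℕ) := by exact_mod_cast h.2 j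
    generalize ((∑ j, x (i, j) : ℕ) : ℝ) = R at *
    generalize ((∑ i, x (i, j) : ℕ) : ℝ) = S at *
    rw [← hcc]
    field_simp
    ring
  · rw [if_neg h, if_neg (fun h' => h (hcond.2 h'))]

end PC

section PD
variable {I J : ℕ}

lemma PD_basis {m : ℕ} (i0 : Fin m) (a : Fin m → ℝ) (ha : ∀ i, 0 < a i) (hasum : ∑ i, a i = 1) :
    ∃ e : OrthonormalBasis (Fin m) ℝ (EuclideanSpace ℝ (Fin m)),
      ∀ i, e i0 i = Real.sqrt (a i) := by
  have hv : Orthonormal ℝ (({i0} : Set (Fin m)).domRestrict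
      (fun _ => (WithLp.toLp 2 (fun i => Real.sqrt (a i)) : EuclideanSpace ℝ (Fin m)))) := by
    constructor
    · intro i
      rw [Set.domRestrict_apply, EuclideanSpace.norm_eq]
      simp [Real.sq_sqrt (ha _).le, hasum]
    · intro i j hij
      exact absurd (Subsingleton.elim i j) hij
  obtain ⟨e, he⟩ := hv.exists_orthonormalBasis_extension_of_card_eq (by simp)
  exact ⟨e, fun i => by rw [he i0 rfl]⟩

lemma PD_orth {m : ℕ} (e : OrthonormalBasis (Fin m) ℝ (EuclideanSpace ℝ (Fin m))) (k k' : Fin m) :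
    ∑ i, e k i * e k' i = if k = k' then 1 else 0 := by
  rw [← orthonormal_iff_ite.1 e.orthonormal k k', PiLp.inner_apply]
  simp [mul_comm]

lemma PD_prodBasis (e : OrthonormalBasis (Fin I) ℝ (EuclideanSpace ℝ (Fin I)))
    (f : OrthonormalBasis (Fin J) ℝ (EuclideanSpace ℝ (Fin J))) :
    ∃ bb : OrthonormalBasis (Fin I × Fin J) ℝ (EuclideanSpace ℝ (Fin I × Fin J)),
      ∀ p q, bb p q = e p.1 q.1 * f p.2 q.2 := by
  have hv : Orthonormal ℝ ((Set.univ : Set (Fin I × Fin J)).domRestrict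
      (fun p => (WithLp.toLp 2 (fun q => e p.1 q.1 * f p.2 q.2) :
        EuclideanSpace ℝ (Fin I × Fin J)))) := by
    rw [orthonormal_iff_ite]
    rintro ⟨⟨k, l⟩, h1⟩ ⟨⟨k', l'⟩, h2⟩
    rw [PiLp.inner_apply, Fintype.sum_prod_type]
    have : ∀ i j, inner ℝ (e k i * f l j) (e k' i * f l' j)
        = (e k i * e k' i) * (f l j * f l' j) := by
      intro i j; simp; ring
    simp only [Set.domRestrict_apply, this, ← Finset.mul_sum, ← Finset.sum_mul, PD_orth]
    by_cases h : k = k' <;> by_cases h' : l = l' <;> simp [h, h']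
  obtain ⟨bb, hbb⟩ := hv.exists_orthonormalBasis_extension_of_card_eq (by simp)
  exact ⟨bb, fun p q => by rw [hbb p trivial]⟩

/-- removal of row and column effects -/
noncomputable def PD_Q (α : Fin I → ℝ) (β : Fin J → ℝ) :
    EuclideanSpace ℝ (Fin I × Fin J) →ₗ[ℝ] EuclideanSpace ℝ (Fin I × Fin J) where
  toFun z := WithLp.toLp 2 (fun q => z q - α q.1 * ∑ i', α i' * z (i', q.2)
    - β q.2 * ∑ j', β j' * z (q.1, j'))
  map_add' x y := by
    ext q
    simp only [PiLp.add_apply, mul_add, Finset.sum_add_distrib]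
    ring
  map_smul' c x := by
    ext q
    simp only [PiLp.smul_apply, smul_eq_mul, RingHom.id_apply, mul_left_comm _ c,
      ← Finset.mul_sum]
    ring

/-- projection off `s` -/
noncomputable def PD_P (s : EuclideanSpace ℝ (Fin I × Fin J)) :
    EuclideanSpace ℝ (Fin I × Fin J) →ₗ[ℝ] EuclideanSpace ℝ (Fin I × Fin J) where
  toFun z := z - inner ℝ s z • s
  map_add' x y := by
    rw [inner_add_right, add_smul]; abel
  map_smul' c x := by
    rw [inner_smul_right, mul_smul, RingHom.id_apply, smul_sub]

lemma PD_law (hI : 2 ≤ I) (hJ : 2 ≤ J) {a : Fin I → ℝ} {b : Fin J → ℝ} (ha : ∀ i, 0 < a i)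
    (hb : ∀ j, 0 < b j) (hasum : ∑ i, a i = 1) (hbsum : ∑ j, b j = 1) :
    (PB_lim (WithLp.toLp 2 fun k : Fin I × Fin J => Real.sqrt (a k.1 * b k.2))).map
      (fun z => PC_g a b (z, 0)) = gammaMeasure (((I - 1) * (J - 1) : ℕ) / 2 : ℝ) (1 / 2) := by
  set i0 : Fin I := ⟨0, by omega⟩
  set j0 : Fin J := ⟨0, by omega⟩
  obtain ⟨e, he⟩ := PD_basis i0 a ha hasum
  obtain ⟨f, hf⟩ := PD_basis j0 b hb hbsum
  obtain ⟨bb, hbb⟩ := PD_prodBasis e f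
  set T : Finset (Fin I × Fin J) := (univ.erase i0) ×ˢ (univ.erase j0) with hTdef
  have hTc : T.card = (I - 1) * (J - 1) := by
    rw [hTdef, card_product, card_erase_of_mem (mem_univ _), card_erase_of_mem (mem_univ _)]
    simp
  have hs : (WithLp.toLp 2 fun k : Fin I × Fin J => Real.sqrt (a k.1 * b k.2)) = bb (i0, j0) := by
    ext q
    rw [hbb, he, hf]
    simp [Real.sqrt_mul (ha _).le]
  have hPb : ∀ p, PD_P (bb (i0, j0)) (bb p) = if p = (i0, j0) then 0 else bb p := by
    intro p
    show bb p - inner ℝ (bb (i0, j0)) (bb p) • bb (i0, j0) = _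
    rw [orthonormal_iff_ite.1 bb.orthonormal]
    by_cases h : p = (i0, j0)
    · simp [h]
    · simp [h, Ne.symm h]
  have hQb : ∀ k l, PD_Q (fun i => Real.sqrt (a i)) (fun j => Real.sqrt (b j)) (bb (k, l)) =
      ((1 : ℝ) - (if i0 = k then 1 else 0) - (if j0 = l then 1 else 0)) • bb (k, l) := by
    intro k l
    ext ⟨i, j⟩
    show bb (k, l) (i, j) - Real.sqrt (a i) * ∑ i', Real.sqrt (a i') * bb (k, l) (i', j)
      - Real.sqrt (b j) * ∑ j', Real.sqrt (b j') * bb (k, l) (i, j') = _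
    simp only [hbb, ← he, ← hf, PiLp.smul_apply, smul_eq_mul]
    have h1 : ∑ i', e i0 i' * (e k i' * f l j) = (if i0 = k then 1 else 0) * f l j := by
      rw [← PD_orth e, Finset.sum_mul]; exact sum_congr rfl fun _ _ => by ring
    have h2 : ∑ j', f j0 j' * (e k i * f l j') = (if j0 = l then 1 else 0) * e k i := by
      rw [← PD_orth f, Finset.sum_mul]; exact sum_congr rfl fun _ _ => by ring
    rw [h1, h2]
    have h3 : e i0 i * (if i0 = k then (1 : ℝ) else 0) = e k i * (if i0 = k then (1 : ℝ) else 0) := by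
      split_ifs with h
      · rw [h]
      · simp
    have h4 : f j0 j * (if j0 = l then (1 : ℝ) else 0) = f l j * (if j0 = l then (1 : ℝ) else 0) := by
      split_ifs with h
      · rw [h]
      · simp
    linear_combination (-f l j) * h3 - e k i * h4
  have hQP : ∀ p, PD_Q (fun i => Real.sqrt (a i)) (fun j => Real.sqrt (b j))
      (PD_P (bb (i0, j0)) (bb p)) = (if p ∈ T then (1 : ℝ) else 0) • bb p := by
    rintro ⟨k, l⟩
    rw [hPb]
    by_cases h : k = i0 <;> by_cases h' : l = j0
    · simp [h, h', hTdef]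
    · rw [if_neg (by simp [h']), hQb]; simp [h, Ne.symm h', hTdef]
    · rw [if_neg (by simp [h]), hQb]; simp [h', Ne.symm h, hTdef]
    · rw [if_neg (by simp [h]), hQb]; simp [h', h, Ne.symm h, Ne.symm h', hTdef]
  have hgq : ∀ z, PC_g a b (z, 0) =
      ‖PD_Q (fun i => Real.sqrt (a i)) (fun j => Real.sqrt (b j)) z‖ ^ 2 := by
    intro z
    rw [PC_g_zero ha hb, EuclideanSpace.norm_sq_eq, Fintype.sum_prod_type]
    simp only [Real.norm_eq_abs, sq_abs]
    rfl
  have hgm : Measurable fun z : EuclideanSpace ℝ (Fin I × Fin J) => PC_g a b (z, 0) :=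
    (PC_g_meas a b).comp (by fun_prop)
  rw [hs, PB_lim, stdGaussian_eq_map_pi_orthonormalBasis bb,
    Measure.map_map hgm (by fun_prop), Measure.map_map (hgm.comp (by fun_prop)) (by fun_prop), ← hTc,
    ← PA_chiSq T (by rw [hTc]; exact Nat.mul_pos (by omega) (by omega))]
  congr 1
  funext w
  show PC_g a b (PD_P (bb (i0, j0)) (∑ p, w p • bb p), 0) = _
  rw [hgq, map_sum, map_sum]
  simp only [map_smul, hQP, smul_smul]
  rw [← real_inner_self_eq_norm_sq, bb.orthonormal.inner_sum]
  rw [← Finset.sum_subset (Finset.subset_univ T)]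
  · exact sum_congr rfl fun p hp => by simp [hp]; ring
  · intro p _ hp; simp [hp]

lemma PD_atom (r s u : ℝ) : gammaMeasure r s {u} = 0 :=
  withDensity_absolutelyContinuous _ _ (by simp)

lemma PD_pmf (n : ℕ) (θ : Fin I → Fin J → ℝ) (x : Fin I × Fin J → ℕ) (hx : ∑ k, x k = n) :
    multinomialPMF n θ (fun i j => x (i, j)) = PB_p (fun k => θ k.1 k.2) x := by
  have h : ∑ i, ∑ j, x (i, j) = n := by rw [← hx, Fintype.sum_prod_type]
  have h2 := Nat.multinomial_spec (s := univ) (f := x)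
  rw [hx] at h2
  rw [multinomialPMF, if_pos h, PB_p, Fintype.prod_prod_type, ← h2, Nat.cast_mul, Nat.cast_prod,
    Fintype.prod_prod_type]
  congr 1
  rw [mul_div_cancel_left₀]
  exact prod_ne_zero_iff.2 fun i _ => prod_ne_zero_iff.2 fun j _ =>
    Nat.cast_ne_zero.2 (Nat.factorial_ne_zero _)

end PD

/-- **Asymptotic null distribution of Pearson's chi-square statistic.**
Fix `I, J ≥ 2` and `θ` in the independence model, `θ_{ij} = a_i b_j` with `a_i, b_j > 0`,
`∑ a_i = ∑ b_j = 1`.  If `X⁽ⁿ⁾` is multinomial with parameters `(n, θ)`, then the Pearson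
statistic `χ²_n` converges in distribution to the chi-square distribution with
`(I-1)(J-1)` degrees of freedom (the Gamma distribution with shape `(I-1)(J-1)/2` and
rate `1/2`): for every `u > 0`,
`P(χ²_n ≥ u) → P(V ≥ u)` as `n → ∞`, where `V ∼ χ²_{(I-1)(J-1)}`. -/
theorem pearsonChiSq_tendsto_chiSquare {I J : ℕ} (hI : 2 ≤ I) (hJ : 2 ≤ J)
    (a : Fin I → ℝ) (b : Fin J → ℝ) (ha : ∀ i, 0 < a i) (hb : ∀ j, 0 < b j)
    (hasum : ∑ i, a i = 1) (hbsum : ∑ j, b j = 1)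
    (θ : Fin I → Fin J → ℝ) (hθ : ∀ i j, θ i j = a i * b j) :
    ∀ u : ℝ, 0 < u →
      Tendsto
        (fun n : ℕ => ∑' x : Fin I → Fin J → ℕ,
          if u ≤ pearsonChiSq n x then multinomialPMF n θ x else 0)
        atTop
        (nhds ((gammaMeasure (((I - 1) * (J - 1) : ℕ) / 2 : ℝ) (1 / 2)
          {v : ℝ | u ≤ v}).toReal)) := by
  intro u _
  have hθ' : θ = fun i j => a i * b j := by funext i j; exact hθ i j
  subst hθ'
  have hpos : ∀ k : Fin I × Fin J, 0 < a k.1 * b k.2 := fun k => mul_pos (ha _) (hb _)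
  have hsum : ∑ k : Fin I × Fin J, a k.1 * b k.2 = 1 := by
    rw [Fintype.sum_prod_type]
    simp only [← Finset.mul_sum, hbsum, mul_one, hasum]
  have key := PB_key hpos hsum (PC_g_meas a b) (PC_g_contAt ha hb) (PD_atom _ _ u)
    (PD_law hI hJ ha hb hasum hbsum)
  refine key.congr' ?_
  filter_upwards [eventually_gt_atTop 0] with n hn
  rw [← (Equiv.curry (Fin I) (Fin J) ℕ).tsum_eq]
  rw [tsum_eq_sum (s := piAntidiag univ n)]
  · refine sum_congr rfl fun x hx => ?_
    have hx' : ∑ k, x k = n := (mem_piAntidiag.1 hx).1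
    have e1 : (Equiv.curry (Fin I) (Fin J) ℕ) x = fun i j => x (i, j) := rfl
    rw [e1, PC_pearson ha hb hasum hbsum hn x, PD_pmf n _ x hx']
  · intro x hx
    have hx' : ∑ k, x k ≠ n := fun h => hx (mem_piAntidiag.2 ⟨h, fun _ _ => mem_univ _⟩)
    have e1 : (Equiv.curry (Fin I) (Fin J) ℕ) x = fun i j => x (i, j) := rfl
    have e2 : ¬ ∑ i, ∑ j, x (i, j) = n := by rwa [← Fintype.sum_prod_type]
    simp only [e1, multinomialPMF, if_neg e2, ite_self]
end

section
/- The set of 3×3×3 tables x ∈ Z_{≥0}^{3×3×3} all three of whose two-dimensional marginals (x_{ij+}), (x_{i+k}), (x_{+jk}) equal the matrix with rows (2,1,1),(1,2,1),(1,1,2) has exactly 18 elements. -/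
open Finset

/-- The common two-dimensional marginal table with rows `(2,1,1), (1,2,1), (1,1,2)`. -/
def M₃ : Fin 3 → Fin 3 → ℕ := ![![2, 1, 1], ![1, 2, 1], ![1, 1, 2]]

/-- The eight free entries, with their bounds. -/
abbrev Par := Fin 3 × Fin 3 × Fin 2 × Fin 2 × Fin 2 × Fin 2 × Fin 2 × Fin 2

/-- Completion of the eight free entries to a table. -/
def tab (a h b c d e f g : ℕ) : Fin 3 → Fin 3 → Fin 3 → ℕ :=
  ![![![a, b, 2 - a - b], ![c, d, 1 - c - d],
      ![2 - a - c, 1 - b - d, 1 - (2 - a - c) - (1 - b - d)]],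
    ![![e, f, 1 - e - f], ![g, h, 2 - g - h],
      ![1 - e - g, 2 - f - h, 1 - (1 - e - g) - (2 - f - h)]],
    ![![2 - a - e, 1 - b - f, 1 - (2 - a - b) - (1 - e - f)],
      ![1 - c - g, 2 - d - h, 1 - (1 - c - d) - (2 - g - h)],
      ![1 - (2 - a - c) - (1 - e - g), 1 - (1 - b - d) - (2 - f - h),
        2 - (1 - (2 - a - c) - (1 - b - d)) - (1 - (1 - e - g) - (2 - f - h))]]]

/-- `tab` on the parameter type. -/
def tabP (p : Par) : Fin 3 → Fin 3 → Fin 3 → ℕ :=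
  tab p.1 p.2.1 p.2.2.1 p.2.2.2.1 p.2.2.2.2.1 p.2.2.2.2.2.1 p.2.2.2.2.2.2.1 p.2.2.2.2.2.2.2

/-- The marginal conditions. -/
abbrev Good (x : Fin 3 → Fin 3 → Fin 3 → ℕ) : Prop :=
  (∀ i j, ∑ k, x i j k = M₃ i j) ∧ (∀ i k, ∑ j, x i j k = M₃ i k) ∧
        (∀ j k, ∑ i, x i j k = M₃ j k)

lemma card_good : ((Finset.univ : Finset Par).filter (fun p => Good (tabP p))).card = 18 := by
  decide +kernel

lemma tabP_inj : Function.Injective tabP := by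
  rintro ⟨a, h, b, c, d, e, f, g⟩ ⟨a2, h2, b2, c2, d2, e2, f2, g2⟩ H
  have hH := fun i j k => congrFun (congrFun (congrFun H i) j) k
  have q1 := hH 0 0 0
  have q2 := hH 0 0 1
  have q3 := hH 0 1 0
  have q4 := hH 0 1 1
  have q5 := hH 1 0 0
  have q6 := hH 1 0 1
  have q7 := hH 1 1 0
  have q8 := hH 1 1 1
  simp [tabP, tab] at q1 q2 q3 q4 q5 q6 q7 q8
  simp only [Prod.mk.injEq, Fin.ext_iff]
  omega

lemma sub3 {a b c m : ℕ} (h : a + b + c = m) : m - a - b = c := by omega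

lemma lt3 {a b c m n : ℕ} (h : a + b + c = m) (hm : m < n) : a < n ∧ b < n := by omega

lemma good_eq (x : Fin 3 → Fin 3 → Fin 3 → ℕ) (hx : Good x) : ∃ p, tabP p = x := by
  obtain ⟨h1, h2, h3⟩ := hx
  simp only [Fin.sum_univ_three] at h1 h2 h3
  have two : M₃ 0 0 < 3 := by decide
  have twob : M₃ 1 1 < 3 := by decide
  have one : M₃ 0 1 < 2 := by decide
  have oneb : M₃ 1 0 < 2 := by decide
  refine ⟨(⟨x 0 0 0, (lt3 (h1 0 0) two).1⟩, ⟨x 1 1 1, (lt3 (h1 1 1) twob).2⟩,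
    ⟨x 0 0 1, (lt3 (h2 0 1) one).1⟩, ⟨x 0 1 0, (lt3 (h1 0 1) one).1⟩,
    ⟨x 0 1 1, (lt3 (h1 0 1) one).2⟩, ⟨x 1 0 0, (lt3 (h1 1 0) oneb).1⟩,
    ⟨x 1 0 1, (lt3 (h1 1 0) oneb).2⟩, ⟨x 1 1 0, (lt3 (h2 1 0) oneb).2⟩), ?_⟩
  -- rows with `i = 0, 1`
  have a02 : 2 - x 0 0 0 - x 0 0 1 = x 0 0 2 := sub3 (h1 0 0)
  have a12 : 1 - x 0 1 0 - x 0 1 1 = x 0 1 2 := sub3 (h1 0 1)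
  have a20 : 2 - x 0 0 0 - x 0 1 0 = x 0 2 0 := sub3 (h2 0 0)
  have a21 : 1 - x 0 0 1 - x 0 1 1 = x 0 2 1 := sub3 (h2 0 1)
  have a22 : 1 - x 0 2 0 - x 0 2 1 = x 0 2 2 := sub3 (h1 0 2)
  have b02 : 1 - x 1 0 0 - x 1 0 1 = x 1 0 2 := sub3 (h1 1 0)
  have b12 : 2 - x 1 1 0 - x 1 1 1 = x 1 1 2 := sub3 (h1 1 1)
  have b20 : 1 - x 1 0 0 - x 1 1 0 = x 1 2 0 := sub3 (h2 1 0)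
  have b21 : 2 - x 1 0 1 - x 1 1 1 = x 1 2 1 := sub3 (h2 1 1)
  have b22 : 1 - x 1 2 0 - x 1 2 1 = x 1 2 2 := sub3 (h1 1 2)
  -- the last layer
  have c (j k : Fin 3) : M₃ j k - x 0 j k - x 1 j k = x 2 j k := sub3 (h3 j k)
  simp only [tabP, tab, a02, a12, a20, a21, a22, b02, b12, b20, b21, b22]
  funext i j k
  fin_cases i
  · fin_cases j <;> fin_cases k <;> rfl
  · fin_cases j <;> fin_cases k <;> rfl
  · refine Eq.trans ?_ (c j k)
    fin_cases j <;> fin_cases k <;> rfl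

/-- **An 18-element fiber of the `3 × 3 × 3` no-three-factor-interaction model.**
The set of nonnegative `3 × 3 × 3` tables all three of whose two-dimensional marginals
equal the matrix with rows `(2,1,1), (1,2,1), (1,1,2)` has exactly `18` elements. -/
theorem fiber333_card_18 :
    Set.ncard
      { x : Fin 3 → Fin 3 → Fin 3 → ℕ |
        (∀ i j, ∑ k, x i j k = M₃ i j) ∧ (∀ i k, ∑ j, x i j k = M₃ i k) ∧
        (∀ j k, ∑ i, x i j k = M₃ j k) } = 18 := by
  have key : { x : Fin 3 → Fin 3 → Fin 3 → ℕ |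
        (∀ i j, ∑ k, x i j k = M₃ i j) ∧ (∀ i k, ∑ j, x i j k = M₃ i k) ∧
        (∀ j k, ∑ i, x i j k = M₃ j k) } =
      Set.image tabP (((Finset.univ : Finset Par).filter (fun p => Good (tabP p)) : Finset Par) : Set Par) := by
    ext x
    constructor
    · intro hx
      obtain ⟨p, rfl⟩ := good_eq x hx
      exact ⟨p, by simpa using hx, rfl⟩
    · rintro ⟨p, hp, rfl⟩
      exact (Finset.mem_filter.mp (Finset.mem_coe.mp hp)).2
  rw [key, Set.ncard_image_of_injective _ tabP_inj, Set.ncard_coe_finset, card_good]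
end

section
/- Let A_{3,3,3} be the configuration matrix of the no-three-factor-interaction model for 3×3×3 tables, sending x ∈ Z^{3×3×3} to its three two-dimensional marginals ((x_{ij+}), (x_{i+k}), (x_{+jk})). Let B consist of: (i) the 27 basic moves, i.e., moves z supported on a block {i_1,i_2}×{j_1,j_2}×{k_1,k_2} (i_1<i_2, j_1<j_2, k_1<k_2) with z_{i_a j_b k_c} = (−1)^{a+b+c} on this block and 0 elsewhere; and (ii) the 54 degree-6 moves obtained as follows: choose one of the three factors, two distinct levels l_1 < l_2 of that factor, and an unordered pair {σ, τ} of 3×3 permutation matrices with disjoint supports (σ_{ab}τ_{ab} = 0 for all a,b); the move has the slice σ − τ at level l_1, the slice τ − σ at level l_2 (in the 3×3 array of the remaining two factors), and 0 elsewhere. Then B is a Markov basis for A_{3,3,3}. -/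
open Finset

/-- `B` is a Markov basis for the configuration matrix of the no-three-factor-interaction
model for `I × J × K` tables (sending a table to its three two-dimensional marginals):
every two nonnegative integer tables with the same two-dimensional marginals are joined by
a path of moves from `±B` through nonnegative integer tables. -/
def IsMarkovBasisN3 {I J K : ℕ} (B : Set (Fin I → Fin J → Fin K → ℤ)) : Prop :=
  ∀ x y : Fin I → Fin J → Fin K → ℕ,
    (∀ i j, ∑ k, x i j k = ∑ k, y i j k) →
    (∀ i k, ∑ j, x i j k = ∑ j, y i j k) →
    (∀ j k, ∑ i, x i j k = ∑ i, y i j k) →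
    Relation.ReflTransGen
      (fun a b : Fin I → Fin J → Fin K → ℕ =>
        (fun i j k => (a i j k : ℤ) - (b i j k : ℤ)) ∈ B ∨
        (fun i j k => (b i j k : ℤ) - (a i j k : ℤ)) ∈ B)
      x y

/-- The 27 basic moves for `3 × 3 × 3` tables: the moves supported on a block
`{i₁,i₂} × {j₁,j₂} × {k₁,k₂}` (`i₁ < i₂`, `j₁ < j₂`, `k₁ < k₂`) with value
`(-1)^{a+b+c}` at `(i_a, j_b, k_c)` and `0` elsewhere. -/
def basicMoves333 : Set (Fin 3 → Fin 3 → Fin 3 → ℤ) :=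
  { z | ∃ i₁ i₂ j₁ j₂ k₁ k₂ : Fin 3, i₁ < i₂ ∧ j₁ < j₂ ∧ k₁ < k₂ ∧
    z = fun p q r =>
      (if p = i₁ then -1 else if p = i₂ then 1 else 0) *
      (if q = j₁ then -1 else if q = j₂ then 1 else 0) *
      (if r = k₁ then -1 else if r = k₂ then 1 else 0) }

/-- The `3 × 3` permutation matrix (over `ℤ`) of a permutation `π` of `{1,2,3}`. -/
def permMat (π : Equiv.Perm (Fin 3)) : Fin 3 → Fin 3 → ℤ :=
  fun a b => if π a = b then 1 else 0

/-- The 54 degree-6 moves for `3 × 3 × 3` tables: choose one of the three factors, two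
distinct levels `l₁ < l₂` of that factor, and a pair `{σ, τ}` of `3 × 3` permutation
matrices with disjoint supports; the move has slice `σ - τ` at level `l₁`, slice `τ - σ`
at level `l₂` (in the array of the remaining two factors), and `0` elsewhere. -/
def deg6Moves333 : Set (Fin 3 → Fin 3 → Fin 3 → ℤ) :=
  { z | ∃ (l₁ l₂ : Fin 3) (π ρ : Equiv.Perm (Fin 3)), l₁ < l₂ ∧ (∀ a, π a ≠ ρ a) ∧
    (z = (fun p q r =>
        if p = l₁ then permMat π q r - permMat ρ q r
        else if p = l₂ then permMat ρ q r - permMat π q r else 0) ∨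
     z = (fun p q r =>
        if q = l₁ then permMat π p r - permMat ρ p r
        else if q = l₂ then permMat ρ p r - permMat π p r else 0) ∨
     z = (fun p q r =>
        if r = l₁ then permMat π p q - permMat ρ p q
        else if r = l₂ then permMat ρ p q - permMat π p q else 0)) }


namespace M333

/-- Tables with integer entries. -/
abbrev Tab := Fin 3 → Fin 3 → Fin 3 → ℤ

/-! ### The sign-pattern search -/

/-- The code of a cell. -/
def cell (i j k : Fin 3) : ℕ := 9 * i.val + 3 * j.val + k.val

/-- The table entry at a code. -/
def atCode (z : Tab) (n : ℕ) : ℤ := z (Fin.ofNat 3 (n / 9)) (Fin.ofNat 3 (n / 3)) (Fin.ofNat 3 n)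

theorem atCode_cell (z : Tab) (i j k : Fin 3) : atCode z (cell i j k) = z i j k := by
  have h : ∀ i j k : Fin 3, Fin.ofNat 3 (cell i j k / 9) = i ∧
      Fin.ofNat 3 (cell i j k / 3) = j ∧ Fin.ofNat 3 (cell i j k) = k := by decide
  obtain ⟨h1, h2, h3⟩ := h i j k
  unfold atCode
  rw [h1, h2, h3]

/-- All cells in the bit mask `M` are positive. -/
def Pos (f : ℕ → ℤ) (M : ℕ) : Prop := ∀ i, M.testBit i = true → 0 < f i

/-- All cells in the bit mask `M` are nonnegative. -/
def NonNeg (f : ℕ → ℤ) (M : ℕ) : Prop := ∀ i, M.testBit i = true → 0 ≤ f i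

theorem pos_or (f : ℕ → ℤ) (A B : ℕ) : Pos f (A ||| B) ↔ Pos f A ∧ Pos f B := by
  unfold Pos
  simp only [Nat.testBit_or, Bool.or_eq_true]
  grind

theorem pos_pow (f : ℕ → ℤ) (a : ℕ) : Pos f (2 ^ a) ↔ 0 < f a := by
  unfold Pos
  simp only [Nat.testBit_two_pow]
  simp

theorem nonNeg_or (f : ℕ → ℤ) (A B : ℕ) : NonNeg f (A ||| B) ↔ NonNeg f A ∧ NonNeg f B := by
  unfold NonNeg
  simp only [Nat.testBit_or, Bool.or_eq_true]
  grind

theorem nonNeg_pow (f : ℕ → ℤ) (a : ℕ) : NonNeg f (2 ^ a) ↔ 0 ≤ f a := by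
  unfold NonNeg
  simp only [Nat.testBit_two_pow]
  simp

theorem Pos.mono {f : ℕ → ℤ} {P A : ℕ} (h : Pos f P) (hs : P &&& A = A) : Pos f A := by
  intro i hi
  rw [← hs, Nat.testBit_and, Bool.and_eq_true] at hi
  exact h i hi.1

theorem NonNeg.disj {f g : ℕ → ℤ} {N v : ℕ} (hfg : ∀ i, g i = - f i) (h : Pos g N)
    (hv : NonNeg f v) : N &&& v = 0 := by
  apply Nat.eq_of_testBit_eq
  intro i
  rw [Nat.testBit_and, Nat.zero_testBit]
  by_contra hc
  rw [Bool.not_eq_false, Bool.and_eq_true] at hc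
  have h1 := h i hc.1
  have h2 := hv i hc.2
  rw [hfg] at h1
  omega

/-- All levels. -/
def lv : List (Fin 3) := [0, 1, 2]

/-- All permutations, as functions. -/
def perms : List (Fin 3 → Fin 3) :=
  [![0, 1, 2], ![0, 2, 1], ![1, 0, 2], ![1, 2, 0], ![2, 0, 1], ![2, 1, 0]]

/-- The masks of positive and of negative cells of the signed basic moves. -/
def basicL : List (ℕ × ℕ) :=
  lv.flatMap fun i => lv.flatMap fun i' => lv.flatMap fun j => lv.flatMap fun j' =>
  lv.flatMap fun k => lv.flatMap fun k' =>
    if i < i' ∧ j < j' ∧ k ≠ k' then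
      [(2 ^ cell i j k ||| 2 ^ cell i j' k' ||| 2 ^ cell i' j k' ||| 2 ^ cell i' j' k,
        2 ^ cell i' j k ||| 2 ^ cell i j' k ||| 2 ^ cell i j k' ||| 2 ^ cell i' j' k')]
    else []

/-- The masks of positive and of negative cells of a signed degree 6 move, where `c l a b` is the
code of the cell at level `l` of the chosen factor. -/
def deg6M (c : Fin 3 → Fin 3 → Fin 3 → ℕ) (l l' : Fin 3) (p q : Fin 3 → Fin 3) : ℕ × ℕ :=
  (2 ^ c l 0 (p 0) ||| 2 ^ c l 1 (p 1) ||| 2 ^ c l 2 (p 2) |||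
     2 ^ c l' 0 (q 0) ||| 2 ^ c l' 1 (q 1) ||| 2 ^ c l' 2 (q 2),
   2 ^ c l 0 (q 0) ||| 2 ^ c l 1 (q 1) ||| 2 ^ c l 2 (q 2) |||
     2 ^ c l' 0 (p 0) ||| 2 ^ c l' 1 (p 1) ||| 2 ^ c l' 2 (p 2))

/-- The masks of the signed degree 6 moves. -/
def deg6L : List (ℕ × ℕ) :=
  lv.flatMap fun l => lv.flatMap fun l' => perms.flatMap fun p => perms.flatMap fun q =>
    if l < l' ∧ p 0 ≠ q 0 ∧ p 1 ≠ q 1 ∧ p 2 ≠ q 2 then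
      [deg6M cell l l' p q, deg6M (fun l a b => cell a l b) l l' p q,
       deg6M (fun l a b => cell a b l) l l' p q]
    else []

/-- The lines, with a distinguished cell. -/
def linesL : List (ℕ × ℕ × ℕ) :=
  lv.flatMap fun a => lv.flatMap fun b => lv.flatMap fun k =>
    [(2 ^ cell a b k, 2 ^ cell a b (k + 1), 2 ^ cell a b (k + 2)),
     (2 ^ cell a k b, 2 ^ cell a (k + 1) b, 2 ^ cell a (k + 2) b),
     (2 ^ cell k a b, 2 ^ cell (k + 1) a b, 2 ^ cell (k + 2) a b)]

/-- The masks of all signed moves, evaluated. -/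
def movesL : List (ℕ × ℕ) :=
  [(5137, 8714), (6177, 16908), (8714, 5137), (10274, 17428), (16908, 6177), (17428, 10274),
   (33921, 66114), (35073, 131652), (66114, 33921), (67842, 132228), (131652, 35073), (132228,
   67842), (41096, 69712), (49416, 135264), (69712, 41096), (82192, 139424), (135264, 49416),
   (139424, 82192), (2621457, 4456458), (3145761, 8650764), (4456458, 2621457), (5242914,
   8912916), (8650764, 3145761), (8912916, 5242914), (17301633, 33816642), (17826049, 67371076),
   (33816642, 17301633), (34603266, 67633284), (67371076, 17826049), (67633284, 34603266),
   (20971656, 35651664), (25166088, 69206112), (35651664, 20971656), (41943312, 71303328),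
   (69206112, 25166088), (71303328, 41943312), (2630144, 4461568), (3162624, 8656896), (4461568,
   2630144), (5260288, 8923136), (8656896, 3162624), (8923136, 5260288), (17367552, 33850368),
   (17957376, 67405824), (33850368, 17367552), (34735104, 67700736), (67405824, 17957376),
   (67700736, 34735104), (21041152, 35692544), (25300992, 69255168), (35692544, 21041152),
   (42082304, 71385088), (69255168, 25300992), (71385088, 42082304), (50449, 139874), (3163153,
   8661002), (17371153, 33857546), (71953, 139916), (5248033, 8921612), (20976769, 35660354),
   (136353, 82698), (8919057, 5259786), (35685393, 21037578), (43169, 82516), (2631713,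
   4473868), (2662529, 4526146), (82698, 136353), (5259786, 8919057), (21037578, 35685393),
   (43274, 136276), (3154466, 8655892), (17310344, 33821776), (139874, 50449), (8661002,
   3163153), (33857546, 17371153), (71778, 50316), (4462626, 2638356), (4490376, 2687568),
   (139916, 71953), (8921612, 5248033), (35660354, 20976769), (50316, 71778), (2638356,
   4462626), (2687568, 4490376), (82516, 43169), (4473868, 2631713), (4526146, 2662529),
   (136276, 43274), (8655892, 3154466), (33821776, 17310344), (25690385, 71565410), (17958017,
   67438658), (17960993, 67420172), (36700433, 71565452), (34637057, 67699268), (25172225,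
   69222980), (69730465, 42205450), (67668097, 34734658), (69240865, 25297420), (22020257,
   42205268), (17369345, 33948740), (3195137, 8785988), (42205450, 69730465), (34734658,
   67668097), (25297420, 69240865), (22020362, 69730388), (17892098, 67404932), (17842952,
   67377248), (71565410, 25690385), (67438658, 17958017), (67420172, 17960993), (36700258,
   25690252), (33851650, 17433220), (8685832, 3277408), (71565452, 36700433), (67699268,
   34637057), (69222980, 25172225), (25690252, 36700258), (17433220, 33851650), (3277408,
   8685832), (42205268, 22020257), (33948740, 17369345), (8785988, 3195137), (69730388,
   22020362), (67404932, 17892098), (67377248, 17842952), (25829888, 71615488), (25305224,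
   69288016), (34742306, 67715092), (36839936, 71636992), (41984264, 71372896), (41953538,
   71320708), (69812736, 42341376), (71352456, 42078288), (71370786, 42075156), (22102528,
   42248192), (21053704, 35790944), (5325058, 9052292), (42341376, 69812736), (42078288,
   71352456), (42075156, 71370786), (22156288, 69773312), (25235728, 69247136), (34620688,
   67643552), (71615488, 25829888), (69288016, 25305224), (67715092, 34742306), (36750336,
   25761792), (35701008, 21106848), (8980752, 5375136), (71636992, 36839936), (71372896,
   41984264), (71320708, 41953538), (25761792, 36750336), (21106848, 35701008), (5375136,
   8980752), (42248192, 22102528), (35790944, 21053704), (9052292, 5325058), (69773312,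
   22156288), (69247136, 25235728), (67643552, 34620688)]

theorem movesL_eq : movesL = basicL ++ deg6L := by decide +kernel

/-- The known positive cells `P` and known negative cells `N` are contradictory. -/
def bad (P N : ℕ) : Bool :=
  !(Nat.land P N).beq 0 || movesL.any fun m =>
    ((Nat.land P m.1).beq m.1 && !(Nat.land N m.2).beq 0) ||
    ((Nat.land N m.1).beq m.1 && !(Nat.land P m.2).beq 0)

/-- Case distinction trees: close a case, or split along a line whose distinguished cell is
known to be positive / negative. -/
inductive Tree : Type
  | c : Tree
  | p : ℕ → Tree → Tree → Tree
  | n : ℕ → Tree → Tree → Tree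

/-- Run a case distinction. -/
def run : Tree → ℕ → ℕ → Bool
  | .c, P, N => bad P N
  | .p i s t, P, N =>
    match linesL[i]? with
    | some l => (Nat.land P l.1).beq l.1 &&
        (run s P (Nat.lor N l.2.1) && run t P (Nat.lor N l.2.2))
    | none => false
  | .n i s t, P, N =>
    match linesL[i]? with
    | some l => (Nat.land N l.1).beq l.1 &&
        (run s (Nat.lor P l.2.1) N && run t (Nat.lor P l.2.2) N)
    | none => false

/-- The case distinction starting from one positive cell. -/
def theTree : Tree :=
  .p 0 (.p 1 (.p 2 (.n 9 (.p 38 .c (.n 11 (.n 28 .c (.n 29 .c (.n 67 .c .c))) (.n 29 (.n 27 .c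
  (.n 66 .c .c)) .c))) (.n 10 (.p 38 .c (.n 11 (.n 28 .c (.n 29 .c (.n 67 .c .c))) (.n 29 (.n 27
  .c .c) .c))) (.n 11 (.n 28 (.p 36 .c (.n 49 .c .c)) .c) (.p 21 (.n 27 (.n 28 (.p 36 .c (.p 37
  .c .c)) .c) (.n 28 .c (.n 29 .c (.n 74 (.p 45 (.n 43 .c .c) .c) .c)))) (.n 56 (.n 27 .c (.n 29
  .c (.p 45 .c (.n 77 .c .c)))) .c))))) (.n 9 (.p 38 (.n 11 (.n 29 .c (.p 30 (.p 63 .c .c) .c))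
  (.n 29 (.p 31 (.p 64 .c .c) .c) .c)) .c) (.n 10 (.p 38 (.n 11 (.n 29 .c (.n 54 .c .c)) (.n 29
  (.p 31 (.p 64 .c .c) .c) .c)) .c) (.n 11 (.p 21 (.n 29 (.n 74 .c (.p 30 (.p 37 (.p 31 .c .c)
  .c) (.p 36 .c (.p 37 .c .c)))) (.n 54 (.p 63 .c (.p 64 .c .c)) .c)) (.n 56 .c (.n 54 .c (.n 29
  (.p 65 (.n 48 .c .c) .c) .c)))) (.n 55 (.p 63 .c (.n 76 .c .c)) .c))))) (.p 2 (.n 10 (.n 11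
  (.n 28 .c (.n 18 .c (.p 37 (.n 39 .c .c) .c))) (.p 12 (.n 18 (.n 56 (.n 27 .c (.n 22 .c (.p 20
  .c (.n 73 .c .c)))) .c) (.n 27 (.n 28 .c (.p 37 (.n 39 .c .c) .c)) (.n 28 (.n 47 (.p 36 (.n 40
  .c .c) .c) .c) .c))) (.n 29 (.n 27 .c (.p 36 .c (.n 50 .c .c))) .c))) (.p 65 .c (.n 11 (.n 28
  (.p 37 (.p 32 .c .c) .c) .c) (.n 56 (.n 27 .c (.n 75 .c .c)) .c)))) (.n 10 (.n 11 (.p 12 (.n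
  18 (.n 56 .c (.n 54 .c (.n 22 .c (.p 20 (.n 46 .c .c) .c)))) (.p 30 (.p 37 .c (.p 38 .c (.p 74
  (.n 46 (.p 42 .c .c) .c) .c))) (.n 28 .c (.p 37 (.n 39 .c .c) .c)))) (.n 29 .c (.p 38 (.p 30
  (.p 63 .c .c) .c) .c))) (.n 55 .c (.n 18 .c (.p 64 (.n 66 .c .c) .c)))) (.p 65 (.n 11 (.p 30
  (.n 48 (.p 77 .c .c) .c) .c) (.n 55 (.n 56 (.n 43 .c .c) .c) .c)) .c)))) (.p 1 (.p 2 (.n 9 (.p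
  13 (.n 19 (.p 47 .c (.n 20 (.n 28 .c (.n 21 .c (.n 29 .c (.n 76 .c .c)))) (.n 29 (.n 27 .c .c)
  .c))) (.n 20 (.n 28 (.p 36 (.n 40 .c .c) .c) .c) (.n 27 (.n 28 .c (.n 29 .c (.n 65 (.p 37 (.n
  39 .c .c) .c) .c))) (.n 28 (.p 36 (.n 40 .c .c) .c) .c)))) (.p 38 .c (.n 11 (.n 28 .c (.n 29
  .c (.n 67 .c .c))) (.n 29 (.p 36 .c .c) .c)))) (.p 47 .c (.n 20 (.n 28 .c (.n 29 .c (.n 76 .c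
  .c))) (.n 29 (.n 27 (.n 69 .c .c) .c) .c)))) (.n 9 (.p 13 (.n 19 (.p 47 (.n 20 (.n 29 .c (.n
  54 .c .c)) (.n 29 (.p 31 (.p 73 .c .c) .c) .c)) .c) (.n 20 (.n 29 (.n 65 .c (.p 31 (.p 36 .c
  (.p 33 .c .c)) (.p 36 (.n 40 .c .c) .c))) (.n 54 .c (.p 63 (.n 67 .c .c) .c))) (.n 55 (.p 63
  (.n 67 .c .c) .c) .c))) (.p 38 (.n 11 (.n 29 .c (.p 63 .c .c)) (.n 29 (.p 31 (.p 64 .c .c) .c)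
  .c)) .c)) (.p 47 (.n 20 (.n 29 .c (.p 33 .c (.p 63 .c .c))) (.n 29 (.p 31 (.p 73 .c .c) .c)
  .c)) .c))) (.p 2 (.n 18 (.p 16 (.p 65 .c (.n 11 (.n 28 (.p 37 (.p 32 .c .c) .c) .c) (.n 56 (.p
  45 .c .c) .c))) (.n 12 (.n 20 (.n 28 .c (.n 38 .c (.p 45 (.n 43 .c .c) .c))) (.n 27 (.n 28 (.n
  38 (.p 36 .c (.p 37 .c .c)) .c) .c) (.n 28 .c (.n 38 .c (.p 45 (.n 43 .c .c) .c))))) (.n 19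
  (.n 20 (.n 28 .c (.n 38 .c (.p 45 (.n 43 .c .c) .c))) (.n 27 (.n 28 (.p 29 .c (.n 38 (.p 36 .c
  (.p 37 .c .c)) .c)) .c) (.n 28 .c (.n 38 .c (.p 45 (.n 43 .c .c) .c))))) (.p 74 .c (.n 20 (.n
  28 (.p 29 .c (.p 46 .c .c)) .c) (.n 56 (.n 27 .c .c) .c)))))) (.p 74 .c (.n 20 (.n 28 (.p 46
  (.p 32 .c .c) .c) .c) (.n 56 (.n 27 (.n 78 .c .c) .c) .c)))) (.n 18 (.p 16 (.p 65 (.n 11 (.p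
  30 (.n 20 .c (.n 48 (.n 56 .c .c) .c)) .c) (.n 55 (.n 56 (.n 43 .c .c) .c) .c)) .c) (.n 12 (.n
  20 (.p 33 (.n 28 .c (.n 38 .c (.p 45 (.n 43 .c .c) .c))) (.p 46 .c (.p 47 .c (.p 65 (.n 37 (.p
  39 .c .c) .c) .c)))) (.n 55 .c (.n 38 (.p 72 (.n 70 .c .c) .c) .c))) (.n 19 (.n 20 (.p 29 (.p
  65 .c (.p 33 (.n 28 .c (.p 45 .c .c)) .c)) (.n 55 .c (.p 72 .c .c))) (.n 55 .c (.n 38 (.p 72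
  (.n 70 .c .c) .c) .c))) (.p 74 (.n 20 (.p 33 .c (.p 29 .c (.n 51 .c (.p 65 .c .c)))) (.n 55
  (.p 29 (.p 73 .c .c) .c) .c)) .c)))) (.p 74 (.n 20 (.p 33 .c (.n 51 .c (.p 68 .c .c))) (.n 55
  (.n 56 (.n 52 .c .c) .c) .c)) .c))))

theorem run_theTree : run theTree 1 0 = true := by
  decide +kernel

/-! ### Irreducible tables vanish -/

/-- No distance-reducing move can be subtracted from `z`. -/
structure Irr (z : Tab) : Prop where
  b : ∀ i i' j j' k k' : Fin 3, i ≠ i' → j ≠ j' → k ≠ k' →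
    0 < z i j k → 0 < z i j' k' → 0 < z i' j k' → 0 < z i' j' k →
    0 ≤ z i' j k ∧ 0 ≤ z i j' k ∧ 0 ≤ z i j k' ∧ 0 ≤ z i' j' k'
  d1 : ∀ (l l' : Fin 3) (p q : Fin 3 → Fin 3), l ≠ l' → p.Injective → q.Injective →
    (∀ a, p a ≠ q a) → (∀ a, 0 < z l a (p a)) → (∀ a, 0 < z l' a (q a)) →
    ∀ a, 0 ≤ z l a (q a) ∧ 0 ≤ z l' a (p a)
  d2 : ∀ (l l' : Fin 3) (p q : Fin 3 → Fin 3), l ≠ l' → p.Injective → q.Injective →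
    (∀ a, p a ≠ q a) → (∀ a, 0 < z a l (p a)) → (∀ a, 0 < z a l' (q a)) →
    ∀ a, 0 ≤ z a l (q a) ∧ 0 ≤ z a l' (p a)
  d3 : ∀ (l l' : Fin 3) (p q : Fin 3 → Fin 3), l ≠ l' → p.Injective → q.Injective →
    (∀ a, p a ≠ q a) → (∀ a, 0 < z a (p a) l) → (∀ a, 0 < z a (q a) l') →
    ∀ a, 0 ≤ z a (q a) l ∧ 0 ≤ z a (p a) l'

def shift (s t u : Fin 3) (z : Tab) : Tab := fun i j k => z (i + s) (j + t) (k + u)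

theorem shift_aux {p : Fin 3 → Fin 3} (hp : p.Injective) (t u : Fin 3) :
    Function.Injective (fun a => p (a - t) + u) := by
  intro a b h
  have h1 : p (a - t) = p (b - t) := add_right_cancel h
  exact sub_left_injective (hp h1)

theorem Irr.shift {z : Tab} (h : Irr z) (s t u : Fin 3) : Irr (shift s t u z) where
  b i i' j j' k k' hi hj hk h1 h2 h3 h4 :=
    h.b (i + s) (i' + s) (j + t) (j' + t) (k + u) (k' + u) (fun e => hi (add_right_cancel e))
      (fun e => hj (add_right_cancel e)) (fun e => hk (add_right_cancel e)) h1 h2 h3 h4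
  d1 l l' p q hl hp hq hpq h1 h2 a := by
    have := h.d1 (l + s) (l' + s) (fun a => p (a - t) + u) (fun a => q (a - t) + u)
      (fun e => hl (add_right_cancel e)) (shift_aux hp t u) (shift_aux hq t u)
      (fun a e => hpq _ (add_right_cancel e))
      (fun a => by have := h1 (a - t); simpa [M333.shift] using this)
      (fun a => by have := h2 (a - t); simpa [M333.shift] using this) (a + t)
    simpa [M333.shift] using this
  d2 l l' p q hl hp hq hpq h1 h2 a := by
    have := h.d2 (l + t) (l' + t) (fun a => p (a - s) + u) (fun a => q (a - s) + u)
      (fun e => hl (add_right_cancel e)) (shift_aux hp s u) (shift_aux hq s u)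
      (fun a e => hpq _ (add_right_cancel e))
      (fun a => by have := h1 (a - s); simpa [M333.shift] using this)
      (fun a => by have := h2 (a - s); simpa [M333.shift] using this) (a + s)
    simpa [M333.shift] using this
  d3 l l' p q hl hp hq hpq h1 h2 a := by
    have := h.d3 (l + u) (l' + u) (fun a => p (a - s) + t) (fun a => q (a - s) + t)
      (fun e => hl (add_right_cancel e)) (shift_aux hp s t) (shift_aux hq s t)
      (fun a e => hpq _ (add_right_cancel e))
      (fun a => by have := h1 (a - s); simpa [M333.shift] using this)
      (fun a => by have := h2 (a - s); simpa [M333.shift] using this) (a + s)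
    simpa [M333.shift] using this

theorem perms_inj : ∀ p ∈ perms, Function.Injective p := by
  unfold perms Function.Injective
  decide

theorem Irr.moves {z : Tab} (h : Irr z) : ∀ m ∈ movesL, Pos (atCode z) m.1 →
    NonNeg (atCode z) m.2 := by
  intro m hm
  rw [movesL_eq, List.mem_append] at hm
  rcases hm with hm | hm
  · simp only [basicL, List.mem_flatMap] at hm
    obtain ⟨i, -, i', -, j, -, j', -, k, -, k', -, hm⟩ := hm
    split_ifs at hm with hc
    · obtain ⟨hi, hj, hk⟩ := hc
      rw [List.mem_singleton] at hm
      subst hm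
      simp only [pos_or, pos_pow, nonNeg_or, nonNeg_pow, atCode_cell]
      rintro ⟨⟨⟨h1, h2⟩, h3⟩, h4⟩
      obtain ⟨g1, g2, g3, g4⟩ := h.b i i' j j' k k' hi.ne hj.ne hk h1 h2 h3 h4
      exact ⟨⟨⟨g1, g2⟩, g3⟩, g4⟩
    · simp at hm
  · simp only [deg6L, List.mem_flatMap] at hm
    obtain ⟨l, -, l', -, p, hp, q, hq, hm⟩ := hm
    have hp := perms_inj p hp
    have hq := perms_inj q hq
    split_ifs at hm with hc
    · obtain ⟨hl, hc⟩ := hc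
      have hpq : ∀ a, p a ≠ q a := by
        rw [Fin.forall_fin_succ, Fin.forall_fin_succ, Fin.forall_fin_one]
        exact hc
      simp only [List.mem_cons, List.not_mem_nil, or_false] at hm
      have key := fun x : Fin 3 → Prop => (by
        rw [Fin.forall_fin_succ, Fin.forall_fin_succ, Fin.forall_fin_one]; rfl :
        (∀ a, x a) ↔ (x 0 ∧ x 1 ∧ x 2))
      rcases hm with rfl | rfl | rfl
      · have := h.d1 l l' p q hl.ne hp hq hpq
        simp only [key] at this
        simp only [deg6M, pos_or, pos_pow, nonNeg_or, nonNeg_pow, atCode_cell]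
        grind
      · have := h.d2 l l' p q hl.ne hp hq hpq
        simp only [key] at this
        simp only [deg6M, pos_or, pos_pow, nonNeg_or, nonNeg_pow, atCode_cell]
        grind
      · have := h.d3 l l' p q hl.ne hp hq hpq
        simp only [key] at this
        simp only [deg6M, pos_or, pos_pow, nonNeg_or, nonNeg_pow, atCode_cell]
        grind
    · simp at hm

/-- All two-dimensional marginals vanish. -/
def Ker (z : Tab) : Prop :=
  (∀ i j, ∑ k, z i j k = 0) ∧ (∀ i k, ∑ j, z i j k = 0) ∧ (∀ j k, ∑ i, z i j k = 0)

theorem sum_rot (g : Fin 3 → ℤ) (k : Fin 3) : ∑ a, g a = g k + g (k + 1) + g (k + 2) := by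
  rw [Fin.sum_univ_three]
  fin_cases k
  · rfl
  · change _ = g 1 + g 2 + g 0
    ring
  · change _ = g 2 + g 0 + g 1
    ring

theorem Ker.shift {z : Tab} (h : Ker z) (s t u : Fin 3) : Ker (shift s t u z) := by
  refine ⟨fun i j => ?_, fun i k => ?_, fun j k => ?_⟩
  · rw [← h.1 (i + s) (j + t)]
    exact Equiv.sum_comp (Equiv.addRight u) (fun k => z (i + s) (j + t) k)
  · rw [← h.2.1 (i + s) (k + u)]
    exact Equiv.sum_comp (Equiv.addRight t) (fun j => z (i + s) j (k + u))
  · rw [← h.2.2 (j + t) (k + u)]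
    exact Equiv.sum_comp (Equiv.addRight s) (fun i => z i (j + t) (k + u))

theorem Ker.neg {z : Tab} (h : Ker z) : Ker (-z) := by
  simpa [Ker] using h

theorem Ker.lines {z : Tab} (h : Ker z) : ∀ l ∈ linesL, Pos (atCode z) l.1 →
    Pos (atCode (-z)) l.2.1 ∨ Pos (atCode (-z)) l.2.2 := by
  intro l hl
  simp only [linesL, List.mem_flatMap, List.mem_cons, List.not_mem_nil, or_false] at hl
  obtain ⟨a, -, b, -, k, -, hl⟩ := hl
  rcases hl with rfl | rfl | rfl
  · have := h.1 a b
    rw [sum_rot _ k] at this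
    simp only [pos_pow, atCode_cell, Pi.neg_apply]
    omega
  · have := h.2.1 a b
    rw [sum_rot _ k] at this
    simp only [pos_pow, atCode_cell, Pi.neg_apply]
    omega
  · have := h.2.2 a b
    rw [sum_rot _ k] at this
    simp only [pos_pow, atCode_cell, Pi.neg_apply]
    omega

theorem beq_t (a b : ℕ) : Nat.beq a b = true ↔ a = b :=
  ⟨Nat.eq_of_beq_eq_true, fun h => by subst h; exact Nat.beq_refl a⟩

theorem beq_f (a b : ℕ) : Nat.beq a b = false ↔ a ≠ b := by
  rw [Ne, ← beq_t, Bool.not_eq_true]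

theorem run_sound {z : Tab} (hk : Ker z) (h : Irr z) (h' : Irr (-z)) (t : Tree) :
    ∀ P N, run t P N = true → Pos (atCode z) P → Pos (atCode (-z)) N → False := by
  have e1 : ∀ i, atCode (-z) i = - atCode z i := fun i => rfl
  have e2 : ∀ i, atCode z i = - atCode (-z) i := fun i => by rw [e1, neg_neg]
  induction t with
  | c =>
    intro P N hr hP hN
    simp only [run, bad, Bool.or_eq_true, List.any_eq_true, Bool.and_eq_true, Bool.not_eq_true',
      beq_t, beq_f] at hr
    rcases hr with hr | ⟨m, hm, ⟨hu, hv⟩ | ⟨hu, hv⟩⟩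
    · exact hr (NonNeg.disj e2 hP (fun i hi => (hN i hi).le))
    · exact hv (NonNeg.disj e1 hN (h.moves m hm (hP.mono hu)))
    · exact hv (NonNeg.disj e2 hP (h'.moves m hm (hN.mono hu)))
  | p i s t hs ht =>
    intro P N hr hP hN
    simp only [run] at hr
    split at hr
    · rename_i l hl
      simp only [Bool.and_eq_true, beq_t] at hr
      obtain ⟨hA, h1, h2⟩ := hr
      rcases hk.lines l (List.mem_of_getElem? hl) (hP.mono hA) with hB | hB
      · exact hs _ _ h1 hP ((pos_or _ _ _).2 ⟨hN, hB⟩)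
      · exact ht _ _ h2 hP ((pos_or _ _ _).2 ⟨hN, hB⟩)
    · simp at hr
  | n i s t hs ht =>
    intro P N hr hP hN
    simp only [run] at hr
    split at hr
    · rename_i l hl
      simp only [Bool.and_eq_true, beq_t] at hr
      obtain ⟨hA, h1, h2⟩ := hr
      have := hk.neg.lines l (List.mem_of_getElem? hl) (hN.mono hA)
      rw [neg_neg] at this
      rcases this with hB | hB
      · exact hs _ _ h1 ((pos_or _ _ _).2 ⟨hP, hB⟩) hN
      · exact ht _ _ h2 ((pos_or _ _ _).2 ⟨hP, hB⟩) hN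
    · simp at hr

theorem irr_nonpos {z : Tab} (hk : Ker z) (h : Irr z) (h' : Irr (-z)) (i j k : Fin 3) :
    z i j k ≤ 0 := by
  by_contra hc
  push Not at hc
  refine run_sound (hk.shift i j k) (h.shift i j k) (h'.shift i j k) theTree 1 0 run_theTree ?_ ?_
  · have := (pos_pow (atCode (shift i j k z)) 0).2 (by
      change 0 < shift i j k z 0 0 0
      simpa [shift] using hc)
    exact this
  · intro n hn
    simp at hn

theorem irr_zero {z : Tab} (hk : Ker z) (h : Irr z) (h' : Irr (-z)) : z = 0 := by
  funext i j k
  have h1 := irr_nonpos hk h h' i j k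
  have h2 := irr_nonpos hk.neg h' (by rwa [neg_neg]) i j k
  simp only [Pi.neg_apply] at h2
  simp only [Pi.zero_apply]
  omega

/-! ### The moves -/

/-- The set of all moves. -/
def mv : Set Tab := basicMoves333 ∪ deg6Moves333

theorem permMat_row (π : Equiv.Perm (Fin 3)) (a : Fin 3) : ∑ b, permMat π a b = 1 := by
  simp [permMat]

theorem permMat_col (π : Equiv.Perm (Fin 3)) (b : Fin 3) : ∑ a, permMat π a b = 1 := by
  have : ∀ a, (π a = b) ↔ (a = π.symm b) := fun a => by rw [Equiv.eq_symm_apply]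
  simp [permMat, this]

theorem ite_sum_zero (l₁ l₂ : Fin 3) (h : l₁ < l₂) (c : ℤ) :
    ∑ p : Fin 3, (if p = l₁ then c else if p = l₂ then -c else 0) = 0 := by
  rw [Fin.sum_univ_three]
  fin_cases l₁ <;> fin_cases l₂ <;> simp at h ⊢

theorem mv_ker : ∀ z ∈ mv, Ker z := by
  intro z hz
  rcases hz with hz | hz
  · obtain ⟨i, i', j, j', k, k', hi, hj, hk, rfl⟩ := hz
    have e : ∀ (l l' : Fin 3), l < l' →
        ∑ p : Fin 3, (if p = l then (-1 : ℤ) else if p = l' then 1 else 0) = 0 := by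
      decide
    refine ⟨fun p q => ?_, fun p r => ?_, fun q r => ?_⟩
    · rw [← Finset.mul_sum, e k k' hk, mul_zero]
    · rw [← Finset.sum_mul, ← Finset.mul_sum, e j j' hj, mul_zero, zero_mul]
    · rw [← Finset.sum_mul, ← Finset.sum_mul, e i i' hi, zero_mul, zero_mul]
  · obtain ⟨l, l', π, ρ, hl, -, hz⟩ := hz
    have e1 : ∀ a b, ∑ p : Fin 3, (if p = l then permMat π a b - permMat ρ a b
        else if p = l' then permMat ρ a b - permMat π a b else 0) = 0 := by
      intro a b
      have := ite_sum_zero l l' hl (permMat π a b - permMat ρ a b)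
      rwa [neg_sub] at this
    have e2 : ∀ p a, ∑ b : Fin 3, (if p = l then permMat π a b - permMat ρ a b
        else if p = l' then permMat ρ a b - permMat π a b else 0) = 0 := by
      intro p a
      split_ifs
      · rw [Finset.sum_sub_distrib, permMat_row, permMat_row, sub_self]
      · rw [Finset.sum_sub_distrib, permMat_row, permMat_row, sub_self]
      · simp
    have e3 : ∀ p b, ∑ a : Fin 3, (if p = l then permMat π a b - permMat ρ a b
        else if p = l' then permMat ρ a b - permMat π a b else 0) = 0 := by
      intro p a
      split_ifs
      · rw [Finset.sum_sub_distrib, permMat_col, permMat_col, sub_self]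
      · rw [Finset.sum_sub_distrib, permMat_col, permMat_col, sub_self]
      · simp
    rcases hz with rfl | rfl | rfl
    · exact ⟨e2, e3, e1⟩
    · exact ⟨fun i j => e2 j i, e1, e3⟩
    · exact ⟨e1, fun i k => e2 k i, fun j k => e3 k j⟩

/-- Moves up to sign. -/
def smv (m : Tab) : Prop := m ∈ mv ∨ -m ∈ mv

theorem smv_ker {m : Tab} (h : smv m) : Ker m := by
  rcases h with h | h
  · exact mv_ker m h
  · have := (mv_ker _ h).neg
    rwa [neg_neg] at this

/-- The sign vector of a pair of levels. -/
def sg (i i' p : Fin 3) : ℤ := if p = i then 1 else if p = i' then -1 else 0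

theorem sg_swap (i i' p : Fin 3) (h : i ≠ i') : sg i' i p = - sg i i' p := by
  unfold sg
  split_ifs <;> simp_all

theorem smv_neg {m : Tab} (h : smv m) : smv (-m) := by
  unfold smv at *
  rw [neg_neg]
  exact h.symm

/-- The signed basic moves. -/
theorem smv_basic (i i' j j' k k' : Fin 3) (hi : i ≠ i') (hj : j ≠ j') (hk : k ≠ k') :
    smv (fun p q r => sg i i' p * sg j j' q * sg k k' r) := by
  wlog h1 : i < i' generalizing i i'
  · have := smv_neg (this i' i hi.symm (lt_of_le_of_ne (not_lt.1 h1) hi.symm))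
    convert this using 1
    funext p q r
    simp only [Pi.neg_apply]
    rw [sg_swap i i' p hi]
    ring
  wlog h2 : j < j' generalizing j j'
  · have := smv_neg (this j' j hj.symm (lt_of_le_of_ne (not_lt.1 h2) hj.symm))
    convert this using 1
    funext p q r
    simp only [Pi.neg_apply]
    rw [sg_swap j j' q hj]
    ring
  wlog h3 : k < k' generalizing k k'
  · have := smv_neg (this k' k hk.symm (lt_of_le_of_ne (not_lt.1 h3) hk.symm))
    convert this using 1
    funext p q r
    simp only [Pi.neg_apply]
    rw [sg_swap k k' r hk]
    ring
  refine Or.inr (Or.inl ⟨i, i', j, j', k, k', h1, h2, h3, ?_⟩)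
  have e : ∀ a b c : Fin 3,
      (if c = a then (-1 : ℤ) else if c = b then 1 else 0) = - sg a b c := by
    intro a b c
    unfold sg
    split_ifs <;> simp
  funext p q r
  simp only [Pi.neg_apply, e]
  ring

/-- The indicator of the graph of a function. -/
def ind (f : Fin 3 → Fin 3) (a b : Fin 3) : ℤ := if f a = b then 1 else 0

/-- The slices of the degree 6 moves. -/
def sl (l l' : Fin 3) (f g : Fin 3 → Fin 3) (p a b : Fin 3) : ℤ :=
  if p = l then ind f a b - ind g a b else if p = l' then ind g a b - ind f a b else 0

theorem sl_swap (l l' : Fin 3) (f g : Fin 3 → Fin 3) (p a b : Fin 3) (h : l ≠ l') :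
    sl l' l f g p a b = - sl l l' f g p a b := by
  unfold sl
  split_ifs <;> simp_all

theorem smv_deg6 (l l' : Fin 3) (f g : Fin 3 → Fin 3) (hl : l ≠ l') (hf : f.Injective)
    (hg : g.Injective) (hfg : ∀ a, f a ≠ g a) :
    smv (fun p q r => sl l l' f g p q r) ∧ smv (fun p q r => sl l l' f g q p r) ∧
    smv (fun p q r => sl l l' f g r p q) := by
  wlog h1 : l < l' generalizing l l'
  · obtain ⟨t1, t2, t3⟩ := this l' l hl.symm (lt_of_le_of_ne (not_lt.1 h1) hl.symm)
    refine ⟨?_, ?_, ?_⟩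
    · convert smv_neg t1 using 1
      funext p q r
      simp [sl_swap l l' f g _ _ _ hl]
    · convert smv_neg t2 using 1
      funext p q r
      simp [sl_swap l l' f g _ _ _ hl]
    · convert smv_neg t3 using 1
      funext p q r
      simp [sl_swap l l' f g _ _ _ hl]
  have bf := Finite.injective_iff_bijective.1 hf
  have bg := Finite.injective_iff_bijective.1 hg
  refine ⟨?_, ?_, ?_⟩
  · exact Or.inl (Or.inr ⟨l, l', Equiv.ofBijective f bf, Equiv.ofBijective g bg, h1, hfg,
      Or.inl rfl⟩)
  · exact Or.inl (Or.inr ⟨l, l', Equiv.ofBijective f bf, Equiv.ofBijective g bg, h1, hfg,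
      Or.inr (Or.inl rfl)⟩)
  · exact Or.inl (Or.inr ⟨l, l', Equiv.ofBijective f bf, Equiv.ofBijective g bg, h1, hfg,
      Or.inr (Or.inr rfl)⟩)

/-- The move `m` reduces the distance when subtracted from `z`. -/
structure Red (z m : Tab) : Prop where
  s : smv m
  le : ∀ i j k, m i j k ≤ 1
  ge : ∀ i j k, -1 ≤ m i j k
  pos : ∀ i j k, 0 < m i j k → 0 < z i j k
  neg : ∃ i j k, m i j k < 0 ∧ z i j k < 0

theorem sg_cases (i i' p : Fin 3) (h : i ≠ i') :
    (p = i ∧ sg i i' p = 1) ∨ (p = i' ∧ sg i i' p = -1) ∨ (sg i i' p = 0) := by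
  unfold sg
  split_ifs <;> simp_all

theorem sg_left (i i' : Fin 3) : sg i i' i = 1 := by simp [sg]

theorem sg_right {i i' : Fin 3} (h : i ≠ i') : sg i i' i' = -1 := by simp [sg, h.symm]

theorem irr_b {z : Tab} (h : ∀ m, ¬ Red z m) (i i' j j' k k' : Fin 3) (hi : i ≠ i')
    (hj : j ≠ j') (hk : k ≠ k') (h1 : 0 < z i j k) (h2 : 0 < z i j' k') (h3 : 0 < z i' j k')
    (h4 : 0 < z i' j' k) :
    0 ≤ z i' j k ∧ 0 ≤ z i j' k ∧ 0 ≤ z i j k' ∧ 0 ≤ z i' j' k' := by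
  by_contra hc
  refine h (fun p q r => sg i i' p * sg j j' q * sg k k' r)
    ⟨smv_basic i i' j j' k k' hi hj hk, ?_, ?_, ?_, ?_⟩
  · intro p q r
    rcases sg_cases i i' p hi with ⟨-, e1⟩ | ⟨-, e1⟩ | e1 <;>
    rcases sg_cases j j' q hj with ⟨-, e2⟩ | ⟨-, e2⟩ | e2 <;>
    rcases sg_cases k k' r hk with ⟨-, e3⟩ | ⟨-, e3⟩ | e3 <;> simp [e1, e2, e3]
  · intro p q r
    rcases sg_cases i i' p hi with ⟨-, e1⟩ | ⟨-, e1⟩ | e1 <;>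
    rcases sg_cases j j' q hj with ⟨-, e2⟩ | ⟨-, e2⟩ | e2 <;>
    rcases sg_cases k k' r hk with ⟨-, e3⟩ | ⟨-, e3⟩ | e3 <;> simp [e1, e2, e3]
  · intro p q r
    rcases sg_cases i i' p hi with ⟨d1, e1⟩ | ⟨d1, e1⟩ | e1 <;>
    rcases sg_cases j j' q hj with ⟨d2, e2⟩ | ⟨d2, e2⟩ | e2 <;>
    rcases sg_cases k k' r hk with ⟨d3, e3⟩ | ⟨d3, e3⟩ | e3 <;> simp_all
  · have s1 := sg_left i i'
    have s2 := sg_left j j'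
    have s3 := sg_left k k'
    have t1 := sg_right hi
    have t2 := sg_right hj
    have t3 := sg_right hk
    by_cases c1 : 0 ≤ z i' j k
    · by_cases c2 : 0 ≤ z i j' k
      · by_cases c3 : 0 ≤ z i j k'
        · by_cases c4 : 0 ≤ z i' j' k'
          · exact absurd ⟨c1, c2, c3, c4⟩ hc
          · exact ⟨i', j', k', by simp [t1, t2, t3], not_le.1 c4⟩
        · exact ⟨i, j, k', by simp [s1, s2, t3], not_le.1 c3⟩
      · exact ⟨i, j', k, by simp [s1, t2, s3], not_le.1 c2⟩
    · exact ⟨i', j, k, by simp [t1, s2, s3], not_le.1 c1⟩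

theorem sl_bd (l l' : Fin 3) (f g : Fin 3 → Fin 3) (p a b : Fin 3) :
    sl l l' f g p a b ≤ 1 ∧ -1 ≤ sl l l' f g p a b := by
  unfold sl ind
  split_ifs <;> simp

theorem sl_pos (l l' : Fin 3) (f g : Fin 3 → Fin 3) (p a b : Fin 3)
    (h : 0 < sl l l' f g p a b) : (p = l ∧ b = f a) ∨ (p = l' ∧ b = g a) := by
  unfold sl ind at h
  split_ifs at h <;> simp_all

theorem sl_neg1 (l l' : Fin 3) (f g : Fin 3 → Fin 3) (a : Fin 3) (h : f a ≠ g a) :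
    sl l l' f g l a (g a) < 0 := by
  simp [sl, ind, h]

theorem sl_neg2 (l l' : Fin 3) (f g : Fin 3 → Fin 3) (a : Fin 3) (hl : l ≠ l') (h : f a ≠ g a) :
    sl l l' f g l' a (f a) < 0 := by
  simp [sl, ind, h.symm, hl.symm]

theorem irr_of_not_red {z : Tab} (h : ∀ m, ¬ Red z m) : Irr z where
  b := irr_b h
  d1 l l' f g hl hf hg hfg h1 h2 a := by
    have hm : ¬ ∃ i j k, sl l l' f g i j k < 0 ∧ z i j k < 0 := fun hn =>
      h _ ⟨(smv_deg6 l l' f g hl hf hg hfg).1, fun _ _ _ => (sl_bd _ _ _ _ _ _ _).1,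
        fun _ _ _ => (sl_bd _ _ _ _ _ _ _).2, fun p q r hp => by
          rcases sl_pos _ _ _ _ _ _ _ hp with ⟨rfl, rfl⟩ | ⟨rfl, rfl⟩
          · exact h1 _
          · exact h2 _, hn⟩
    exact ⟨not_lt.1 fun hc => hm ⟨_, _, _, sl_neg1 l l' f g a (hfg a), hc⟩,
      not_lt.1 fun hc => hm ⟨_, _, _, sl_neg2 l l' f g a hl (hfg a), hc⟩⟩
  d2 l l' f g hl hf hg hfg h1 h2 a := by
    have hm : ¬ ∃ i j k, sl l l' f g j i k < 0 ∧ z i j k < 0 := fun hn =>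
      h _ ⟨(smv_deg6 l l' f g hl hf hg hfg).2.1, fun _ _ _ => (sl_bd _ _ _ _ _ _ _).1,
        fun _ _ _ => (sl_bd _ _ _ _ _ _ _).2, fun p q r hp => by
          rcases sl_pos _ _ _ _ _ _ _ hp with ⟨rfl, rfl⟩ | ⟨rfl, rfl⟩
          · exact h1 _
          · exact h2 _, hn⟩
    exact ⟨not_lt.1 fun hc => hm ⟨_, _, _, sl_neg1 l l' f g a (hfg a), hc⟩,
      not_lt.1 fun hc => hm ⟨_, _, _, sl_neg2 l l' f g a hl (hfg a), hc⟩⟩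
  d3 l l' f g hl hf hg hfg h1 h2 a := by
    have hm : ¬ ∃ i j k, sl l l' f g k i j < 0 ∧ z i j k < 0 := fun hn =>
      h _ ⟨(smv_deg6 l l' f g hl hf hg hfg).2.2, fun _ _ _ => (sl_bd _ _ _ _ _ _ _).1,
        fun _ _ _ => (sl_bd _ _ _ _ _ _ _).2, fun p q r hp => by
          rcases sl_pos _ _ _ _ _ _ _ hp with ⟨rfl, rfl⟩ | ⟨rfl, rfl⟩
          · exact h1 _
          · exact h2 _, hn⟩
    exact ⟨not_lt.1 fun hc => hm ⟨_, _, _, sl_neg1 l l' f g a (hfg a), hc⟩,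
      not_lt.1 fun hc => hm ⟨_, _, _, sl_neg2 l l' f g a hl (hfg a), hc⟩⟩

/-! ### Distance reduction -/

/-- Tables with natural entries. -/
abbrev NTab := Fin 3 → Fin 3 → Fin 3 → ℕ

/-- The difference of two tables. -/
def df (x y : NTab) : Tab := fun i j k => (x i j k : ℤ) - (y i j k : ℤ)

/-- The distance of two tables. -/
def dist1 (x y : NTab) : ℤ := ∑ i, ∑ j, ∑ k, |df x y i j k|

/-- Being joined by a move. -/
def step (a b : NTab) : Prop := df a b ∈ mv ∨ df b a ∈ mv

theorem df_swap (x y : NTab) : df y x = - df x y := by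
  funext i j k
  simp [df]

theorem dist1_swap (x y : NTab) : dist1 y x = dist1 x y := by
  unfold dist1
  simp [df_swap x y]

theorem step_symm {a b : NTab} (h : step a b) : step b a := Or.symm h

theorem reduce {x y : NTab} (hk : Ker (df x y)) {m : Tab} (h : Red (df x y) m) :
    ∃ x' : NTab, step x x' ∧ Ker (df x' y) ∧ dist1 x' y < dist1 x y := by
  have hm := smv_ker h.s
  have hx : ∀ i j k, (((x i j k : ℤ) - m i j k).toNat : ℤ) = (x i j k : ℤ) - m i j k := by
    intro i j k
    apply Int.toNat_of_nonneg
    have h1 := h.le i j k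
    have h2 := h.pos i j k
    simp only [df] at h2
    by_cases h3 : 0 < m i j k
    · have := h2 h3
      omega
    · omega
  refine ⟨fun i j k => ((x i j k : ℤ) - m i j k).toNat, ?_, ?_, ?_⟩
  · have e : df x (fun i j k => ((x i j k : ℤ) - m i j k).toNat) = m := by
      funext i j k
      simp only [df, hx]
      ring
    rcases h.s with hs | hs
    · exact Or.inl (by rwa [e])
    · exact Or.inr (by rwa [df_swap, e])
  · have e : df (fun i j k => ((x i j k : ℤ) - m i j k).toNat) y =
        fun i j k => df x y i j k - m i j k := by
      funext i j k
      simp only [df, hx]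
      ring
    rw [e]
    refine ⟨fun i j => ?_, fun i k => ?_, fun j k => ?_⟩
    · rw [Finset.sum_sub_distrib, hk.1, hm.1, sub_zero]
    · rw [Finset.sum_sub_distrib, hk.2.1, hm.2.1, sub_zero]
    · rw [Finset.sum_sub_distrib, hk.2.2, hm.2.2, sub_zero]
  · have e : ∀ i j k, |df (fun i j k => ((x i j k : ℤ) - m i j k).toNat) y i j k| ≤
        |df x y i j k| - m i j k := by
      intro i j k
      have h1 := h.le i j k
      have h2 := h.pos i j k
      have h3 := h.ge i j k
      simp only [df, hx] at h2 ⊢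
      by_cases h4 : 0 < m i j k
      · have := h2 h4
        rw [abs_of_nonneg (by omega), abs_of_nonneg (by omega)]
        omega
      · rcases abs_cases ((x i j k : ℤ) - m i j k - y i j k) with ⟨e, _⟩ | ⟨e, _⟩ <;>
        rcases abs_cases ((x i j k : ℤ) - y i j k) with ⟨e', _⟩ | ⟨e', _⟩ <;>
        rw [e, e'] <;> omega
    have e0 : dist1 x y = ∑ i, ∑ j, ∑ k, (|df x y i j k| - m i j k) := by
      unfold dist1
      simp only [Finset.sum_sub_distrib, hm.1]
      simp
    rw [e0]
    obtain ⟨i, j, k, hm0, hz0⟩ := h.neg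
    unfold dist1
    refine Finset.sum_lt_sum (fun i _ => Finset.sum_le_sum fun j _ =>
      Finset.sum_le_sum fun k _ => e i j k) ⟨i, Finset.mem_univ _, ?_⟩
    refine Finset.sum_lt_sum (fun j _ =>
      Finset.sum_le_sum fun k _ => e i j k) ⟨j, Finset.mem_univ _, ?_⟩
    refine Finset.sum_lt_sum (fun k _ => e i j k) ⟨k, Finset.mem_univ _, ?_⟩
    have h3 := h.ge i j k
    simp only [df, hx] at hz0 ⊢
    rw [abs_of_nonpos (by omega), abs_of_nonpos (by omega)]
    omega

theorem connected (n : ℕ) : ∀ x y : NTab, Ker (df x y) → dist1 x y < n →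
    Relation.ReflTransGen step x y := by
  induction n with
  | zero =>
    intro x y _ hd
    exfalso
    have : 0 ≤ dist1 x y := Finset.sum_nonneg fun _ _ => Finset.sum_nonneg fun _ _ =>
      Finset.sum_nonneg fun _ _ => abs_nonneg _
    simp only [Nat.cast_zero] at hd
    omega
  | succ n ih =>
    intro x y hk hd
    push_cast at hd
    by_cases h1 : ∃ m, Red (df x y) m
    · obtain ⟨m, hm⟩ := h1
      obtain ⟨x', hs, hk', hd'⟩ := reduce hk hm
      exact Relation.ReflTransGen.head hs (ih x' y hk' (by omega))
    by_cases h2 : ∃ m, Red (df y x) m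
    · obtain ⟨m, hm⟩ := h2
      have hk2 : Ker (df y x) := by rw [df_swap]; exact hk.neg
      obtain ⟨y', hs, hk', hd'⟩ := reduce hk2 hm
      refine Relation.ReflTransGen.tail (ih x y' ?_ ?_) (step_symm hs)
      · rw [df_swap]
        exact hk'.neg
      · rw [dist1_swap y' x, dist1_swap x y] at *
        omega
    have hz : df x y = 0 := by
      refine irr_zero hk (irr_of_not_red (not_exists.1 h1)) ?_
      rw [← df_swap]
      exact irr_of_not_red (not_exists.1 h2)
    have hxy : x = y := by
      funext i j k
      have := congrFun (congrFun (congrFun hz i) j) k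
      simp only [df, Pi.zero_apply] at this
      omega
    rw [hxy]

end M333

/-- **A Markov basis for the `3 × 3 × 3` no-three-factor-interaction model.**
The 27 basic moves together with the 54 degree-6 moves built from pairs of disjoint
`3 × 3` permutation matrices all lie in `Ker_ℤ(A_{3,3,3})` and form a Markov basis for the
configuration matrix of the no-three-factor-interaction model for `3 × 3 × 3` tables. -/
theorem markovBasis333 :
    (∀ z ∈ basicMoves333 ∪ deg6Moves333,
      (∀ i j, ∑ k, z i j k = 0) ∧ (∀ i k, ∑ j, z i j k = 0) ∧
      (∀ j k, ∑ i, z i j k = 0)) ∧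
    IsMarkovBasisN3 (basicMoves333 ∪ deg6Moves333) := by
  refine ⟨M333.mv_ker, ?_⟩
  intro x y h1 h2 h3
  have hk : M333.Ker (M333.df x y) := by
    refine ⟨fun i j => ?_, fun i k => ?_, fun j k => ?_⟩
    · simp only [M333.df, Finset.sum_sub_distrib]
      have := h1 i j
      zify at this
      rw [this, sub_self]
    · simp only [M333.df, Finset.sum_sub_distrib]
      have := h2 i k
      zify at this
      rw [this, sub_self]
    · simp only [M333.df, Finset.sum_sub_distrib]
      have := h3 j k
      zify at this
      rw [this, sub_self]
  exact M333.connected ((M333.dist1 x y).toNat + 1) x y hk (by push_cast; omega)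
end
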